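/- arXiv:1907.01228 — 3 statements merged into one kernel-verified Lean document; each statement's English description precedes it below -/
import Mathlib

section
/- Let P be a subset of the Euclidean plane ℝ² that is simply connected (as a topological subspace), and let a, b, c ∈ ℝ² be points such that the closed segments [a,b], [b,c] and [c,a] are all contained in P. Then the convex hull of {a,b,c} (the filled triangle abc) is contained in P. -/
open unitInterval in
lemma lift_end_eq {Y : Type*} [TopologicalSpace Y] [SimplyConnectedSpace Y]
    (F : C(Y, {z : ℂ // z ≠ 0})) {x y : Y} (γ γ' : Path x y) (L L' : C(I, ℂ))
    (hL : ∀ t, Complex.exp (L t) = F (γ t)) (hL' : ∀ t, Complex.exp (L' t) = F (γ' t))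
    (h0 : L 0 = L' 0) : L 1 = L' 1 := by
  have cov := Complex.isCoveringMap_exp
  have hh : Path.Homotopic γ γ' := SimplyConnectedSpace.paths_homotopic γ γ'
  have h1 : (F.comp γ.toContinuousMap).HomotopicRel (F.comp γ'.toContinuousMap) {0,1} :=
    Nonempty.map (fun H => ContinuousMap.HomotopyRel.compContinuousMap H F) hh
  have e1 : (F.comp γ.toContinuousMap) 0 = ⟨_, (L 0).exp_ne_zero⟩ := Subtype.ext (hL 0).symm
  have e2 : (F.comp γ'.toContinuousMap) 0 = ⟨_, (L 0).exp_ne_zero⟩ :=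
    Subtype.ext (by rw [h0]; exact (hL' 0).symm)
  have := cov.liftPath_apply_one_eq_of_homotopicRel h1 (L 0) e1 e2
  rw [← (cov.eq_liftPath_iff' e1).2 ⟨funext fun t => Subtype.ext (hL t), rfl⟩,
    ← (cov.eq_liftPath_iff' e2 (Γ := L')).2
      ⟨funext fun t => Subtype.ext (hL' t), h0.symm⟩] at this
  exact this

lemma mem_slit {A B : ℂ} (hA : A ≠ 0)
    (h : ∀ t : ℝ, 0 ≤ t → t ≤ 1 → (1 - t : ℂ) * A + t * B ≠ 0) : B / A ∈ Complex.slitPlane := by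
  by_contra hn
  rw [Complex.mem_slitPlane_iff] at hn
  push Not at hn
  obtain ⟨h1, h2⟩ := hn
  set r := (B / A).re with hr
  have hB : B / A = (r : ℂ) := Complex.ext (by simp [hr]) (by simpa using h2)
  have hB' : B = r * A := by rw [← hB]; field_simp
  have hp : (0:ℝ) < 1 - r := by linarith
  apply h (1 / (1 - r)) (by positivity) (by rw [div_le_one hp]; linarith)
  have : (1 - (r:ℂ)) ≠ 0 := by exact_mod_cast hp.ne'
  rw [hB']; push_cast; field_simp; ring

lemma slit_interp {z : ℂ} (hz : z ∈ Complex.slitPlane) (t : unitInterval) :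
    (1 - (t:ℝ) : ℂ) + (t:ℝ) * z ∈ Complex.slitPlane := by
  have h0 := t.2.1
  have h1 := t.2.2
  rw [Complex.mem_slitPlane_iff] at hz ⊢
  simp only [Complex.add_re, Complex.add_im, Complex.sub_re, Complex.sub_im, Complex.one_re,
    Complex.one_im, Complex.ofReal_re, Complex.ofReal_im, Complex.mul_re, Complex.mul_im]
  rcases eq_or_lt_of_le h0 with h | h
  · left; rw [← h]; norm_num
  · rcases hz with hz | hz
    · left; nlinarith [mul_pos h hz]
    · right; simp [hz]; exact fun h' => h.ne' (by simp [h'])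

noncomputable def segLift (w z : ℂ) (hz : z ∈ Complex.slitPlane) : Path w (w + Complex.log z) where
  toFun t := w + Complex.log ((1 - (t:ℝ) : ℂ) + (t:ℝ) * z)
  continuous_toFun := by
    refine continuous_const.add (Continuous.clog (by fun_prop) fun t => slit_interp hz t)
  source' := by simp
  target' := by simp

lemma exp_segLift {w z A B : ℂ} (hz : z ∈ Complex.slitPlane) (hw : Complex.exp w = A)
    (hB : B = z * A) (t : unitInterval) :
    Complex.exp (segLift w z hz t) = (1 - (t:ℝ) : ℂ) * A + (t:ℝ) * B := by
  change Complex.exp (w + Complex.log _) = _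
  rw [Complex.exp_add, Complex.exp_log (Complex.slitPlane_ne_zero (slit_interp hz t)), hw, hB]
  ring

noncomputable def segPath {P : Set (EuclideanSpace ℝ (Fin 2))} {a b : EuclideanSpace ℝ (Fin 2)}
    (h : segment ℝ a b ⊆ P) :
    Path (⟨a, h (left_mem_segment ℝ a b)⟩ : P) ⟨b, h (right_mem_segment ℝ a b)⟩ where
  toFun t := ⟨(1 - (t:ℝ)) • a + (t:ℝ) • b,
    h ⟨1 - t, t, by linarith [t.2.2], t.2.1, by ring, rfl⟩⟩
  continuous_toFun := by fun_prop
  source' := by simp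
  target' := by simp

lemma im_sign {A B C : ℂ} {s t u : ℝ} (hs : 0 < s) (ht : 0 < t) (hu : 0 < u)
    (h : s * A + t * B + u * C = 0) (hBA : B / A ∈ Complex.slitPlane)
    (hCB : C / B ∈ Complex.slitPlane) (hCA : C / A ∈ Complex.slitPlane)
    (hl : Complex.log (B / A) + Complex.log (C / B) = Complex.log (C / A)) : False := by
  have hA : A ≠ 0 := by rintro rfl; simp at hBA
  have hB : B ≠ 0 := by rintro rfl; simp at hCB
  have key : (s:ℂ) + t * (B / A) + u * (C / A) = 0 := by field_simp; linear_combination h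
  have key2 : (s:ℂ) * (A / B) + t + u * (C / B) = 0 := by field_simp; linear_combination h
  have hz : (A / B) = (B / A)⁻¹ := by simp
  rw [hz] at key2
  have harg := congrArg Complex.im hl
  simp only [Complex.add_im, Complex.log_im] at harg
  generalize B / A = z at *
  generalize C / A = w at *
  generalize C / B = v at *
  have i1 := congrArg Complex.im key
  have r1 := congrArg Complex.re key
  have i2 := congrArg Complex.im key2
  simp [Complex.inv_im] at i1 i2 r1
  have hz0 : 0 < Complex.normSq z := Complex.normSq_pos.2 (Complex.slitPlane_ne_zero hBA)
  have i3 : u * v.im = (s / Complex.normSq z) * z.im := by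
    have : s * (-z.im / Complex.normSq z) = - ((s / Complex.normSq z) * z.im) := by ring
    linarith
  have hq : 0 < s / Complex.normSq z := by positivity
  generalize s / Complex.normSq z = q at *
  rcases lt_trichotomy z.im 0 with hz' | hz' | hz'
  · have a1 : v.im < 0 := by nlinarith
    have a2 : 0 < w.im := by nlinarith
    have := Complex.arg_neg_iff.2 hz'
    have := Complex.arg_neg_iff.2 a1
    have := Complex.arg_nonneg_iff.2 a2.le
    linarith
  · have a2 : w.im = 0 := by
      rw [hz'] at i1; simpa [hu.ne'] using i1
    rw [Complex.mem_slitPlane_iff] at hBA hCA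
    simp only [hz', a2, ne_eq, not_true_eq_false, or_false] at hBA hCA
    have := mul_pos ht hBA
    have := mul_pos hu hCA
    linarith
  · have a1 : 0 < v.im := by nlinarith
    have a2 : w.im < 0 := by nlinarith
    have := Complex.arg_nonneg_iff.2 hz'.le
    have := Complex.arg_nonneg_iff.2 a1.le
    have := Complex.arg_neg_iff.2 a2
    linarith

theorem triangle_fill
    (P : Set (EuclideanSpace ℝ (Fin 2)))
    (hP : SimplyConnectedSpace ↥P)
    (a b c : EuclideanSpace ℝ (Fin 2))
    (hab : segment ℝ a b ⊆ P)
    (hbc : segment ℝ b c ⊆ P)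
    (hca : segment ℝ c a ⊆ P) :
    convexHull ℝ {a, b, c} ⊆ P := by
  intro p hp
  by_contra hpP
  have hac : segment ℝ a c ⊆ P := by rwa [segment_symm]
  rw [convexHull_insert (by simp), convexHull_pair] at hp
  simp only [convexJoin_singleton_left, Set.mem_iUnion] at hp
  obtain ⟨d, ⟨y, z, hy, hz, hyz, rfl⟩, ⟨s, r, hs, hr, hsr, hpe⟩⟩ := hp
  let f : EuclideanSpace ℝ (Fin 2) → ℂ := fun x => ⟨x 0 - p 0, x 1 - p 1⟩
  have hf : Continuous f := by
    have : f = fun x => ((x 0 - p 0 : ℝ) : ℂ) + ((x 1 - p 1 : ℝ) : ℂ) * Complex.I := by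
      funext x; simp [f, Complex.ext_iff]
    rw [this]; fun_prop
  have hfz : ∀ x, f x = 0 → x = p := by
    intro x hx
    simp only [f, Complex.ext_iff, Complex.zero_re, Complex.zero_im] at hx
    ext i; fin_cases i
    · simpa using sub_eq_zero.1 hx.1
    · simpa using sub_eq_zero.1 hx.2
  have hfP : ∀ x ∈ P, f x ≠ 0 := fun x hx h0 => hpP (hfz x h0 ▸ hx)
  have hfl : ∀ (x y : EuclideanSpace ℝ (Fin 2)) (t : ℝ),
      f ((1 - t) • x + t • y) = (1 - t : ℂ) * f x + t * f y := by
    intro x y t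
    apply Complex.ext <;> simp [f] <;> ring
  have hcomb : (s : ℂ) * f a + (r * y : ℝ) * f b + (r * z : ℝ) * f c = 0 := by
    have e0 := congrArg (fun v => v 0) hpe
    have e1 := congrArg (fun v => v 1) hpe
    simp at e0 e1
    have hz' : z = 1 - y := by linarith
    have hs' : s = 1 - r := by linarith
    subst hz' hs'
    apply Complex.ext <;> simp [f] <;> linarith
  have slit : ∀ x y, segment ℝ x y ⊆ P → f y / f x ∈ Complex.slitPlane := by
    intro x y h
    refine mem_slit (hfP x (h (left_mem_segment ℝ x y))) fun t h0 h1 => ?_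
    rw [← hfl]
    exact hfP _ (h ⟨1 - t, t, by linarith, h0, by ring, rfl⟩)
  have sab := slit a b hab
  have sbc := slit b c hbc
  have sac := slit a c hac
  have hA : f a ≠ 0 := hfP a (hab (left_mem_segment ℝ a b))
  have hB : f b ≠ 0 := hfP b (hbc (left_mem_segment ℝ b c))
  have hs0 : s ≠ 0 := by
    rintro rfl
    have : r = 1 := by linarith
    subst this
    exact hpP (hbc ⟨y, z, hy, hz, hyz, by simpa using hpe⟩)
  have hr0 : r ≠ 0 := by
    rintro rfl
    have : s = 1 := by linarith
    subst this
    apply hpP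
    have : a = p := by simpa using hpe
    exact this ▸ hab (left_mem_segment ℝ a b)
  have hy0 : y ≠ 0 := by
    rintro rfl
    have : z = 1 := by linarith
    subst this
    exact hpP (hac ⟨s, r, hs, hr, hsr, by simpa using hpe⟩)
  have hz0 : z ≠ 0 := by
    rintro rfl
    have : y = 1 := by linarith
    subst this
    exact hpP (hab ⟨s, r, hs, hr, hsr, by simpa using hpe⟩)
  have hs := lt_of_le_of_ne hs hs0.symm
  have hr := lt_of_le_of_ne hr hr0.symm
  have hy := lt_of_le_of_ne hy hy0.symm
  have hz := lt_of_le_of_ne hz hz0.symm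
  refine im_sign hs (mul_pos hr hy) (mul_pos hr hz) hcomb sab sbc sac ?_
  let F : C(P, {z : ℂ // z ≠ 0}) :=
    ⟨fun x => ⟨f x, hfP x x.2⟩, (hf.comp continuous_subtype_val).subtype_mk _⟩
  let w := Complex.log (f a)
  have hw : Complex.exp w = f a := Complex.exp_log hA
  have hw2 : Complex.exp (w + Complex.log (f b / f a)) = f b := by
    rw [Complex.exp_add, hw, Complex.exp_log (Complex.slitPlane_ne_zero sab)]; field_simp
  let L1 := segLift w _ sab
  let L2 := segLift (w + Complex.log (f b / f a)) _ sbc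
  let L3 := segLift w _ sac
  have k1 : ∀ t, Complex.exp (L1 t) = F (segPath hab t) := fun t => by
    rw [exp_segLift sab hw (B := f b) (by field_simp)]; exact (hfl a b t).symm
  have k2 : ∀ t, Complex.exp (L2 t) = F (segPath hbc t) := fun t => by
    rw [exp_segLift sbc hw2 (B := f c) (by field_simp)]; exact (hfl b c t).symm
  have k3 : ∀ t, Complex.exp (L3 t) = F (segPath hac t) := fun t => by
    rw [exp_segLift sac hw (B := f c) (by field_simp)]; exact (hfl a c t).symm
  have := lift_end_eq F ((segPath hab).trans (segPath hbc)) (segPath hac)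
    (L1.trans L2).toContinuousMap L3.toContinuousMap
    (fun t => by
      change Complex.exp ((L1.trans L2) t) = _
      rw [Path.trans_apply, Path.trans_apply]
      split_ifs
      · exact k1 _
      · exact k2 _) k3
    ((L1.trans L2).source.trans L3.source.symm)
  have h2 := (L1.trans L2).target.symm.trans (this.trans L3.target)
  linear_combination h2
end

section
/- Let P be a subset of the Euclidean plane ℝ² that is simply connected (as a topological subspace), and let a, b, c, d ∈ ℝ² be points such that the closed segments [a,b], [b,c], [c,d] and [d,a] are all contained in P, the segments [a,b] and [c,d] are disjoint, the segments [b,c] and [d,a] are disjoint, and none of the four points lies in the convex hull of the other three. Then the convex hull of {a,b,c,d} (the filled convex quadrilateral) is contained in P. -/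
open unitInterval in
theorem qf_seg (P : Set (EuclideanSpace ℝ (Fin 2))) (p : EuclideanSpace ℝ (Fin 2))
    (f : C(P, {z : ℂ // z ≠ 0}))
    (hf : ∀ x : P, (f x : ℂ) = ⟨x.1 0 - p 0, x.1 1 - p 1⟩)
    (u v : P) (huv : segment ℝ u.1 v.1 ⊆ P)
    (hpos : 0 < (u.1 0 - p 0) * (v.1 1 - p 1) - (u.1 1 - p 1) * (v.1 0 - p 0)) :
    ∃ γ : Path.Homotopic.Quotient (f u) (f v), (∃ γ' : Path u v, γ = (.mk (γ'.map f.continuous))) ∧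
      ∀ e : (fun z : ℂ ↦ (⟨_, z.exp_ne_zero⟩ : {z : ℂ // z ≠ 0})) ⁻¹' {f u}, e.1.im < (Complex.isCoveringMap_exp.monodromy γ e : ℂ).im := by
  have hmem : ∀ t : I, AffineMap.lineMap u.1 v.1 (t : ℝ) ∈ P := fun t => huv (by
    rw [segment_eq_image_lineMap]; exact ⟨t, t.2, rfl⟩)
  let γ' : Path u v :=
    { toFun := fun t => ⟨AffineMap.lineMap u.1 v.1 (t : ℝ), hmem t⟩
      continuous_toFun := by
        refine Continuous.subtype_mk ?_ _
        exact AffineMap.lineMap_continuous.comp continuous_subtype_val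
      source' := by ext1; simp
      target' := by ext1; simp }
  refine ⟨_, ⟨γ', rfl⟩, fun e => ?_⟩
  set w : ℂ := (f v : ℂ) / (f u : ℂ) with hw
  have hu0 : (f u : ℂ) ≠ 0 := (f u).2
  have hwim : 0 < w.im := by
    have hn : 0 < Complex.normSq (f u : ℂ) := Complex.normSq_pos.2 hu0
    rw [hw, Complex.div_im, ← sub_div]
    apply div_pos _ hn
    rw [hf, hf]
    simp only
    linarith
  have hslit : ∀ t : I, 1 + ((t : ℝ) : ℂ) * (w - 1) ∈ Complex.slitPlane := by
    intro t
    rw [Complex.mem_slitPlane_iff]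
    rcases eq_or_lt_of_le t.2.1 with h | h
    · left; simp [← h]
    · right
      have : 0 < (t : ℝ) * w.im := mul_pos h hwim
      simpa using this.ne'
  let Γ : C(I, ℂ) := ⟨fun t => e.1 + Complex.log (1 + ((t : ℝ) : ℂ) * (w - 1)), by
    refine continuous_const.add (Continuous.clog (by fun_prop) hslit)⟩
  have he : Complex.exp e.1 = f u := congrArg Subtype.val e.2
  have hΓ : Γ = Complex.isCoveringMap_exp.liftPath ((γ'.map f.continuous : Path _ _) : C(I, _)) e.1
      ((γ'.map f.continuous).source.trans e.2.symm) := by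
    rw [Complex.isCoveringMap_exp.eq_liftPath_iff']
    refine ⟨?_, ?_⟩
    · ext t
      show Complex.exp (e.1 + Complex.log (1 + ((t : ℝ) : ℂ) * (w - 1))) = (f (γ' t) : ℂ)
      rw [Complex.exp_add, he, Complex.exp_log (Complex.slitPlane_ne_zero (hslit t))]
      have : (f u : ℂ) * (1 + ((t : ℝ) : ℂ) * (w - 1)) = f u + ((t : ℝ) : ℂ) * (f v - f u) := by
        rw [hw]; field_simp
      rw [this, hf, hf, hf]
      apply Complex.ext <;>
        simp [γ', AffineMap.lineMap_apply] <;> ring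
    · simp [Γ]
  have h1 : (Complex.isCoveringMap_exp.monodromy (.mk (γ'.map f.continuous)) e : ℂ) = Γ 1 := by
    rw [hΓ]; rfl
  rw [h1]
  have : Γ 1 = e.1 + Complex.log w := by simp [Γ]
  rw [this, Complex.add_im, Complex.log_im]
  have h2 : 0 ≤ w.arg := Complex.arg_nonneg_iff.2 hwim.le
  have h3 : w.arg ≠ 0 := fun h => hwim.ne' (Complex.arg_eq_zero_iff.1 h).2
  have := lt_of_le_of_ne h2 h3.symm
  linarith

theorem qf_topo (P : Set (EuclideanSpace ℝ (Fin 2))) (hP : SimplyConnectedSpace ↥P)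
    (a b c d p : EuclideanSpace ℝ (Fin 2)) (hp : p ∉ P)
    (hab : segment ℝ a b ⊆ P) (hbc : segment ℝ b c ⊆ P)
    (hcd : segment ℝ c d ⊆ P) (hda : segment ℝ d a ⊆ P)
    (h1 : 0 < (a 0 - p 0) * (b 1 - p 1) - (a 1 - p 1) * (b 0 - p 0))
    (h2 : 0 < (b 0 - p 0) * (c 1 - p 1) - (b 1 - p 1) * (c 0 - p 0))
    (h3 : 0 < (c 0 - p 0) * (d 1 - p 1) - (c 1 - p 1) * (d 0 - p 0))
    (h4 : 0 < (d 0 - p 0) * (a 1 - p 1) - (d 1 - p 1) * (a 0 - p 0)) : False := by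
  let f : C(P, {z : ℂ // z ≠ 0}) := ⟨fun x => ⟨⟨x.1 0 - p 0, x.1 1 - p 1⟩, by
      intro h
      apply hp
      have e0 : x.1 0 - p 0 = 0 := congrArg Complex.re h
      have e1 : x.1 1 - p 1 = 0 := congrArg Complex.im h
      have : p = x.1 := by
        ext i; fin_cases i
        · simp; linarith
        · simp; linarith
      rw [this]; exact x.2⟩, by
    refine Continuous.subtype_mk ?_ _
    have : (fun x : P => (⟨x.1 0 - p 0, x.1 1 - p 1⟩ : ℂ)) =
        fun x : P => ((x.1 0 - p 0 : ℝ) : ℂ) + ((x.1 1 - p 1 : ℝ) : ℂ) * Complex.I := by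
      ext x; apply Complex.ext <;> simp
    rw [this]
    fun_prop⟩
  have hf : ∀ x : P, (f x : ℂ) = ⟨x.1 0 - p 0, x.1 1 - p 1⟩ := fun x => rfl
  let a' : P := ⟨a, hab (left_mem_segment ℝ a b)⟩
  let b' : P := ⟨b, hbc (left_mem_segment ℝ b c)⟩
  let c' : P := ⟨c, hcd (left_mem_segment ℝ c d)⟩
  let d' : P := ⟨d, hda (left_mem_segment ℝ d a)⟩
  obtain ⟨γ1, ⟨g1, rfl⟩, m1⟩ := qf_seg P p f hf a' b' hab h1
  obtain ⟨γ2, ⟨g2, rfl⟩, m2⟩ := qf_seg P p f hf b' c' hbc h2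
  obtain ⟨γ3, ⟨g3, rfl⟩, m3⟩ := qf_seg P p f hf c' d' hcd h3
  obtain ⟨γ4, ⟨g4, rfl⟩, m4⟩ := qf_seg P p f hf d' a' hda h4
  have hom := SimplyConnectedSpace.paths_homotopic (g1.trans (g2.trans (g3.trans g4))) (Path.refl a')
  have hom2 := hom.map f
  have hq : (Path.Homotopic.Quotient.mk (g1.map f.continuous)).trans
      ((Path.Homotopic.Quotient.mk (g2.map f.continuous)).trans
      ((Path.Homotopic.Quotient.mk (g3.map f.continuous)).trans
      (Path.Homotopic.Quotient.mk (g4.map f.continuous)))) = .refl (f a') := by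
    have := Path.Homotopic.Quotient.eq.2 hom2
    simp only [Path.map_trans, Path.Homotopic.Quotient.mk_trans] at this
    exact this
  let e : (fun z : ℂ ↦ (⟨_, z.exp_ne_zero⟩ : {z : ℂ // z ≠ 0})) ⁻¹' {f a'} :=
    ⟨Complex.log (f a'), by
      simp only [Set.mem_preimage, Set.mem_singleton_iff]
      ext1
      exact Complex.exp_log (f a').2⟩
  have key := congrArg (fun q => (Complex.isCoveringMap_exp.monodromy q e : ℂ).im) hq
  simp only [IsCoveringMap.monodromy_trans_apply, IsCoveringMap.monodromy_refl, id] at key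
  have := m1 e
  have := m2 (Complex.isCoveringMap_exp.monodromy (.mk (g1.map f.continuous)) e)
  have := m3 (Complex.isCoveringMap_exp.monodromy (.mk (g2.map f.continuous))
    (Complex.isCoveringMap_exp.monodromy (.mk (g1.map f.continuous)) e))
  have := m4 (Complex.isCoveringMap_exp.monodromy (.mk (g3.map f.continuous))
    (Complex.isCoveringMap_exp.monodromy (.mk (g2.map f.continuous))
    (Complex.isCoveringMap_exp.monodromy (.mk (g1.map f.continuous)) e)))
  linarith

theorem qf_mem3 {x y z w : EuclideanSpace ℝ (Fin 2)} {α β γ δ : ℝ} (hα : 0 < α)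
    (hβ : 0 ≤ β) (hγ : 0 ≤ γ) (hδ : 0 ≤ δ) (hs : α = β + γ + δ)
    (h0 : α * x 0 = β * y 0 + γ * z 0 + δ * w 0)
    (h1 : α * x 1 = β * y 1 + γ * z 1 + δ * w 1) : x ∈ convexHull ℝ {y, z, w} := by
  have hx : x = ∑ i : Fin 3, (![β / α, γ / α, δ / α] i) • (![y, z, w] i) := by
    ext i; fin_cases i
    · simp [Fin.sum_univ_three]; field_simp; linarith
    · simp [Fin.sum_univ_three]; field_simp; linarith
  rw [hx]
  refine (convex_convexHull ℝ _).sum_mem ?_ ?_ ?_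
  · intro i _; fin_cases i <;> simp <;> positivity
  · simp [Fin.sum_univ_three]; field_simp; linarith
  · intro i _; apply subset_convexHull; fin_cases i <;> simp

theorem qf_seg_inter {x y z w : EuclideanSpace ℝ (Fin 2)} {α β γ δ : ℝ} (hα : 0 ≤ α)
    (hβ : 0 ≤ β) (hγ : 0 ≤ γ) (hδ : 0 ≤ δ) (hs : α + β = γ + δ) (hp : 0 < α + β)
    (h0 : α * x 0 + β * y 0 = γ * z 0 + δ * w 0)
    (h1 : α * x 1 + β * y 1 = γ * z 1 + δ * w 1)
    (hd : Disjoint (segment ℝ x y) (segment ℝ z w)) : False := by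
  have hp' : 0 < γ + δ := hs ▸ hp
  have hq : (α / (α + β)) • x + (β / (α + β)) • y ∈ segment ℝ x y :=
    ⟨_, _, by positivity, by positivity, by field_simp, rfl⟩
  refine Set.disjoint_left.1 hd hq ⟨γ / (γ + δ), δ / (γ + δ), by positivity, by positivity,
    by field_simp, ?_⟩
  rw [← hs]
  ext i; fin_cases i
  · simp; field_simp; linarith
  · simp; field_simp; linarith

/-- Orientation of a triple of points. -/
def qfO (x y z : EuclideanSpace ℝ (Fin 2)) : ℝ :=
  (y 0 - x 0) * (z 1 - x 1) - (y 1 - x 1) * (z 0 - x 0)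

theorem qf_noncol {x y z w : EuclideanSpace ℝ (Fin 2)} (h : qfO x y z = 0)
    (hx : x ∉ convexHull ℝ {y, z, w}) (hy : y ∉ convexHull ℝ {x, z, w})
    (hz : z ∉ convexHull ℝ {x, y, w}) : False := by
  unfold qfO at h
  by_cases hxy : x = y
  · apply hx; apply subset_convexHull; simp [hxy]
  have hn : 0 < (y 0 - x 0)^2 + (y 1 - x 1)^2 := by
    by_contra hc
    apply hxy
    have e0 : y 0 - x 0 = 0 := by nlinarith [sq_nonneg (y 0 - x 0), sq_nonneg (y 1 - x 1)]
    have e1 : y 1 - x 1 = 0 := by nlinarith [sq_nonneg (y 0 - x 0), sq_nonneg (y 1 - x 1)]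
    ext i; fin_cases i
    · simp; linarith
    · simp; linarith
  -- n (z - x) = s (y - x)
  set n := (y 0 - x 0)^2 + (y 1 - x 1)^2 with hnd
  set s := (y 0 - x 0) * (z 0 - x 0) + (y 1 - x 1) * (z 1 - x 1) with hsd
  have e0 : n * (z 0 - x 0) = s * (y 0 - x 0) := by
    rw [hnd, hsd]; linear_combination (-(y 1 - x 1)) * h
  have e1 : n * (z 1 - x 1) = s * (y 1 - x 1) := by
    rw [hnd, hsd]; linear_combination (y 0 - x 0) * h
  rcases lt_or_ge s 0 with hs | hs
  · -- x between z and y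
    apply hx
    exact qf_mem3 (α := n - s) (β := -s) (γ := n) (δ := 0) (by linarith) (by linarith) hn.le le_rfl
      (by ring) (by linarith) (by linarith)
  rcases le_or_gt s n with hs2 | hs2
  · apply hz
    exact qf_mem3 (α := n) (β := n - s) (γ := s) (δ := 0) hn (by linarith) hs le_rfl
      (by ring) (by linarith) (by linarith)
  · apply hy
    exact qf_mem3 (α := s) (β := s - n) (γ := n) (δ := 0) (by linarith) (by linarith) hn.le le_rfl
      (by ring) (by linarith) (by linarith)

theorem qf_orient {a b c d : EuclideanSpace ℝ (Fin 2)}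
    (hdisj₁ : Disjoint (segment ℝ a b) (segment ℝ c d))
    (hdisj₂ : Disjoint (segment ℝ b c) (segment ℝ d a))
    (ha : a ∉ convexHull ℝ {b, c, d})
    (hb : b ∉ convexHull ℝ {a, c, d})
    (hc : c ∉ convexHull ℝ {a, b, d})
    (hd : d ∉ convexHull ℝ {a, b, c}) :
    (0 < qfO b c d ∧ 0 < qfO a c d ∧ 0 < qfO a b d ∧ 0 < qfO a b c) ∨
    (qfO b c d < 0 ∧ qfO a c d < 0 ∧ qfO a b d < 0 ∧ qfO a b c < 0) := by
  have hD : qfO a b c ≠ 0 := fun h => qf_noncol h ha hb hc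
  have es : qfO b c d + qfO a b d = qfO a c d + qfO a b c := by unfold qfO; ring
  have e0 : qfO b c d * a 0 + qfO a b d * c 0 = qfO a c d * b 0 + qfO a b c * d 0 := by
    unfold qfO; ring
  have e1 : qfO b c d * a 1 + qfO a b d * c 1 = qfO a c d * b 1 + qfO a b c * d 1 := by
    unfold qfO; ring
  generalize qfO b c d = A at *
  generalize qfO a c d = B at *
  generalize qfO a b d = C at *
  generalize qfO a b c = D at *
  have pa : ¬ (0 < A ∧ 0 ≤ B ∧ C ≤ 0 ∧ 0 ≤ D) := fun ⟨h1, h2, h3, h4⟩ => ha <|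
    qf_mem3 (α := A) (β := B) (γ := -C) (δ := D) h1 h2 (by linarith) h4 (by linarith)
      (by linarith) (by linarith)
  have na : ¬ (A < 0 ∧ B ≤ 0 ∧ 0 ≤ C ∧ D ≤ 0) := fun ⟨h1, h2, h3, h4⟩ => ha <|
    qf_mem3 (α := -A) (β := -B) (γ := C) (δ := -D) (by linarith) (by linarith) (by linarith)
      (by linarith) (by linarith) (by linarith) (by linarith)
  have pb : ¬ (0 < B ∧ 0 ≤ A ∧ 0 ≤ C ∧ D ≤ 0) := fun ⟨h1, h2, h3, h4⟩ => hb <|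
    qf_mem3 (α := B) (β := A) (γ := C) (δ := -D) (by linarith) (by linarith) (by linarith)
      (by linarith) (by linarith) (by linarith) (by linarith)
  have nb : ¬ (B < 0 ∧ A ≤ 0 ∧ C ≤ 0 ∧ 0 ≤ D) := fun ⟨h1, h2, h3, h4⟩ => hb <|
    qf_mem3 (α := -B) (β := -A) (γ := -C) (δ := D) (by linarith) (by linarith) (by linarith)
      (by linarith) (by linarith) (by linarith) (by linarith)
  have pc : ¬ (0 < C ∧ A ≤ 0 ∧ 0 ≤ B ∧ 0 ≤ D) := fun ⟨h1, h2, h3, h4⟩ => hc <|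
    qf_mem3 (α := C) (β := -A) (γ := B) (δ := D) (by linarith) (by linarith) (by linarith)
      (by linarith) (by linarith) (by linarith) (by linarith)
  have nc : ¬ (C < 0 ∧ 0 ≤ A ∧ B ≤ 0 ∧ D ≤ 0) := fun ⟨h1, h2, h3, h4⟩ => hc <|
    qf_mem3 (α := -C) (β := A) (γ := -B) (δ := -D) (by linarith) (by linarith) (by linarith)
      (by linarith) (by linarith) (by linarith) (by linarith)
  have pd : ¬ (0 < D ∧ 0 ≤ A ∧ B ≤ 0 ∧ 0 ≤ C) := fun ⟨h1, h2, h3, h4⟩ => hd <|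
    qf_mem3 (α := D) (β := A) (γ := -B) (δ := C) (by linarith) (by linarith) (by linarith)
      (by linarith) (by linarith) (by linarith) (by linarith)
  have nd : ¬ (D < 0 ∧ A ≤ 0 ∧ 0 ≤ B ∧ C ≤ 0) := fun ⟨h1, h2, h3, h4⟩ => hd <|
    qf_mem3 (α := -D) (β := -A) (γ := B) (δ := -C) (by linarith) (by linarith) (by linarith)
      (by linarith) (by linarith) (by linarith) (by linarith)
  -- the pairs {a,b} | {c,d}
  have s1 : ¬ (0 ≤ A ∧ B ≤ 0 ∧ C ≤ 0 ∧ 0 ≤ D ∧ 0 < A - B) := fun ⟨h1, h2, h3, h4, h5⟩ =>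
    qf_seg_inter (α := A) (β := -B) (γ := -C) (δ := D) (by linarith) (by linarith) (by linarith)
      (by linarith) (by linarith) (by linarith) (by linarith) (by linarith) hdisj₁
  have s2 : ¬ (A ≤ 0 ∧ 0 ≤ B ∧ 0 ≤ C ∧ D ≤ 0 ∧ 0 < B - A) := fun ⟨h1, h2, h3, h4, h5⟩ =>
    qf_seg_inter (α := -A) (β := B) (γ := C) (δ := -D) (by linarith) (by linarith) (by linarith)
      (by linarith) (by linarith) (by linarith) (by linarith) (by linarith) hdisj₁
  have s3 : ¬ (0 ≤ A ∧ 0 ≤ B ∧ C ≤ 0 ∧ D ≤ 0 ∧ 0 < B - C) := fun ⟨h1, h2, h3, h4, h5⟩ =>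
    qf_seg_inter (α := B) (β := -C) (γ := -D) (δ := A) (by linarith) (by linarith) (by linarith)
      (by linarith) (by linarith) (by linarith) (by linarith) (by linarith) hdisj₂
  have s4 : ¬ (A ≤ 0 ∧ B ≤ 0 ∧ 0 ≤ C ∧ 0 ≤ D ∧ 0 < C - B) := fun ⟨h1, h2, h3, h4, h5⟩ =>
    qf_seg_inter (α := -B) (β := C) (γ := D) (δ := -A) (by linarith) (by linarith) (by linarith)
      (by linarith) (by linarith) (by linarith) (by linarith) (by linarith) hdisj₂
  clear e0 e1 ha hb hc hd hdisj₁ hdisj₂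
  rcases lt_trichotomy A 0 with hA | hA | hA <;> rcases lt_trichotomy B 0 with hB | hB | hB <;>
  rcases lt_trichotomy C 0 with hC | hC | hC <;> rcases lt_or_gt_of_ne hD with hD' | hD' <;>
  grind

theorem qf_pos (P : Set (EuclideanSpace ℝ (Fin 2))) (hP : SimplyConnectedSpace ↥P)
    (a b c d : EuclideanSpace ℝ (Fin 2))
    (hab : segment ℝ a b ⊆ P) (hbc : segment ℝ b c ⊆ P)
    (hcd : segment ℝ c d ⊆ P) (hda : segment ℝ d a ⊆ P)
    (hA : 0 < qfO b c d) (hB : 0 < qfO a c d) (hC : 0 < qfO a b d) (hD : 0 < qfO a b c) :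
    convexHull ℝ {a, b, c, d} ⊆ P := by
  intro p hp
  by_contra hpP
  rw [convexHull_insert (by simp), convexHull_insert (by simp), convexHull_pair,
    mem_convexJoin] at hp
  obtain ⟨a', ha', y, hy, hp⟩ := hp
  rw [mem_convexJoin] at hy
  obtain ⟨b', hb', z, hz, hy⟩ := hy
  rw [Set.mem_singleton_iff] at ha' hb'
  subst ha' hb'
  obtain ⟨s1, t1, hs1, ht1, hst1, rfl⟩ := hp
  obtain ⟨s2, t2, hs2, ht2, hst2, rfl⟩ := hy
  obtain ⟨s3, t3, hs3, ht3, hst3, rfl⟩ := hz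
  obtain ⟨wa, hwa⟩ : ∃ w, w = s1 := ⟨_, rfl⟩
  obtain ⟨wb, hwb⟩ : ∃ w, w = t1 * s2 := ⟨_, rfl⟩
  obtain ⟨wc, hwc⟩ : ∃ w, w = t1 * (t2 * s3) := ⟨_, rfl⟩
  obtain ⟨wd, hwd⟩ : ∃ w, w = t1 * (t2 * t3) := ⟨_, rfl⟩
  have ha0 : 0 ≤ wa := by rw [hwa]; positivity
  have hb0 : 0 ≤ wb := by rw [hwb]; positivity
  have hc0 : 0 ≤ wc := by rw [hwc]; positivity
  have hd0 : 0 ≤ wd := by rw [hwd]; positivity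
  have hsum : wa + wb + wc + wd = 1 := by
    rw [hwa, hwb, hwc, hwd]
    linear_combination hst1 + t1 * hst2 + t1 * t2 * hst3
  have hpe : s1 • a' + t1 • (s2 • b' + t2 • (s3 • c + t3 • d)) =
      wa • a' + wb • b' + wc • c + wd • d := by
    rw [hwa, hwb, hwc, hwd]; module
  rw [hpe] at hpP
  clear hpe hwa hwb hwc hwd
  have hwa' : wa = 1 - wb - wc - wd := by linarith
  have key : ∀ u v, 0 ≤ u → 0 ≤ v → ∀ X Y : ℝ, 0 < X → 0 < Y → (u = 0 → v = 0 → False) →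
      0 < u * X + v * Y := by
    intro u v hu hv X Y hX hY h
    rcases hu.eq_or_lt with h1 | h1
    · rcases hv.eq_or_lt with h2 | h2
      · exact (h h1.symm h2.symm).elim
      · positivity
    · positivity
  refine qf_topo P hP a' b' c d _ hpP hab hbc hcd hda ?_ ?_ ?_ ?_
  · have := key wc wd hc0 hd0 _ _ hD hC (by
      rintro rfl rfl; apply hpP; apply hab
      exact ⟨wa, wb, ha0, hb0, by linarith, by simp⟩)
    refine this.trans_eq ?_
    simp [qfO, hwa']; ring
  · have := key wd wa hd0 ha0 _ _ hA hD (by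
      intro h1 h2; apply hpP; apply hbc
      exact ⟨wb, wc, hb0, hc0, by linarith, by simp [h1, h2]⟩)
    refine this.trans_eq ?_
    simp [qfO, hwa']; ring
  · have := key wa wb ha0 hb0 _ _ hB hA (by
      intro h1 h2; apply hpP; apply hcd
      exact ⟨wc, wd, hc0, hd0, by linarith, by simp [h1, h2]⟩)
    refine this.trans_eq ?_
    simp [qfO, hwa']; ring
  · have := key wb wc hb0 hc0 _ _ hC hB (by
      intro h1 h2; apply hpP; apply hda
      exact ⟨wd, wa, hd0, ha0, by linarith, by simp [h1, h2, add_comm]⟩)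
    refine this.trans_eq ?_
    simp [qfO, hwa']; ring

theorem quadrilateral_fill
    (P : Set (EuclideanSpace ℝ (Fin 2)))
    (hP : SimplyConnectedSpace ↥P)
    (a b c d : EuclideanSpace ℝ (Fin 2))
    (hab : segment ℝ a b ⊆ P)
    (hbc : segment ℝ b c ⊆ P)
    (hcd : segment ℝ c d ⊆ P)
    (hda : segment ℝ d a ⊆ P)
    (hdisj₁ : Disjoint (segment ℝ a b) (segment ℝ c d))
    (hdisj₂ : Disjoint (segment ℝ b c) (segment ℝ d a))
    (ha : a ∉ convexHull ℝ {b, c, d})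
    (hb : b ∉ convexHull ℝ {a, c, d})
    (hc : c ∉ convexHull ℝ {a, b, d})
    (hd : d ∉ convexHull ℝ {a, b, c}) :
    convexHull ℝ {a, b, c, d} ⊆ P := by
  rcases qf_orient hdisj₁ hdisj₂ ha hb hc hd with ⟨h1, h2, h3, h4⟩ | ⟨h1, h2, h3, h4⟩
  · exact qf_pos P hP a b c d hab hbc hcd hda h1 h2 h3 h4
  · have hset : ({a, b, c, d} : Set (EuclideanSpace ℝ (Fin 2))) = {a, d, c, b} := by
      ext x; simp only [Set.mem_insert_iff, Set.mem_singleton_iff]; tauto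
    rw [hset]
    unfold qfO at h1 h2 h3 h4
    refine qf_pos P hP a d c b ?_ ?_ ?_ ?_ ?_ ?_ ?_ ?_
    · rwa [segment_symm]
    · rwa [segment_symm]
    · rwa [segment_symm]
    · rwa [segment_symm]
    all_goals unfold qfO; linarith
end

section
/- Let P ⊆ ℝ² be a simple polygon region with vertices v₁, …, vₙ, let p ∈ P, and let C be a connected component of P ∖ Vis(p), where Vis(p) = {q ∈ P : [p,q] ⊆ P}. Then the intersection of C with the frontier of P is a connected set. -/
/-- `P` is a simple polygon region with the `n` vertices `v 0, …, v (n-1)`: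
a compact subset of the plane with nonempty interior, equal to the closure of its
interior, whose frontier is the union of the `n` edges `[v i, v (i+1)]` (indices
mod `n`), such that consecutive edges meet exactly in their common vertex and
non-consecutive edges are disjoint. -/
def IsSimplePolygonRegion {n : ℕ} [NeZero n]
    (P : Set (EuclideanSpace ℝ (Fin 2))) (v : Fin n → EuclideanSpace ℝ (Fin 2)) : Prop :=
  3 ≤ n ∧ Function.Injective v ∧ IsCompact P ∧ (interior P).Nonempty ∧
  P = closure (interior P) ∧
  frontier P = ⋃ i : Fin n, segment ℝ (v i) (v (i + 1)) ∧
  (∀ i : Fin n, segment ℝ (v i) (v (i + 1)) ∩ segment ℝ (v (i + 1)) (v (i + 1 + 1))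
      = {v (i + 1)}) ∧
  (∀ i j : Fin n, i ≠ j → j ≠ i + 1 → i ≠ j + 1 →
    Disjoint (segment ℝ (v i) (v (i + 1))) (segment ℝ (v j) (v (j + 1))))


noncomputable def windN (w : ℕ → ℂ) (m : ℕ) (x : ℂ) : ℝ :=
  ∑ k ∈ Finset.range m, Complex.arg ((w (k+1) - x) / (w k - x))

lemma ratio_slit {a b x : ℂ} (h : x ∉ segment ℝ a b) : (b - x) / (a - x) ∈ Complex.slitPlane := by
  by_contra hs
  rw [Complex.mem_slitPlane_iff, not_or] at hs
  push Not at hs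
  obtain ⟨h1, h2⟩ := hs
  have ha : a - x ≠ 0 := by
    intro h0
    apply h
    rw [sub_eq_zero] at h0
    rw [← h0]; exact left_mem_segment ℝ a b
  set r : ℝ := -((b - x) / (a - x)).re with hr
  have hr0 : 0 ≤ r := by linarith
  have e1 : (b - x) / (a - x) = ((-r : ℝ) : ℂ) := by
    apply Complex.ext
    · simp [hr]
    · simpa using h2
  rw [div_eq_iff ha] at e1
  apply h
  refine ⟨r / (1 + r), 1 / (1 + r), by positivity, by positivity, by field_simp; ring, ?_⟩
  have h3 : ((1 + r : ℝ) : ℂ) ≠ 0 := by exact_mod_cast (by positivity : (1 + r) ≠ 0)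
  push_cast at e1 h3
  simp only [Complex.real_smul]
  push_cast
  field_simp
  linear_combination e1

lemma term_cont {a b x : ℂ} (h : x ∉ segment ℝ a b) :
    ContinuousAt (fun y => Complex.arg ((b - y) / (a - y))) x := by
  have ha : a - x ≠ 0 := by
    intro h0
    apply h
    rw [sub_eq_zero] at h0
    rw [← h0]; exact left_mem_segment ℝ a b
  have h1 : ContinuousAt (fun y => (b - y) / (a - y)) x := by
    apply ContinuousAt.div _ _ ha <;> fun_prop
  exact ContinuousAt.comp (f := fun y => (b - y) / (a - y)) (Complex.continuousAt_arg (ratio_slit h)) h1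

lemma prod_tele (f : ℕ → ℂ) (m : ℕ) (h : ∀ k ≤ m, f k ≠ 0) :
    ∏ k ∈ Finset.range m, f (k+1) / f k = f m / f 0 := by
  induction m with
  | zero => simp [h 0 le_rfl]
  | succ m ih =>
    rw [Finset.prod_range_succ, ih (fun k hk => h k (by omega))]
    have := h m (by omega)
    have := h 0 (by omega)
    field_simp

lemma windN_int {w : ℕ → ℂ} {m : ℕ} (hm : w m = w 0) {x : ℂ} (h0 : x ≠ w 0)
    (h : ∀ k < m, x ∉ segment ℝ (w k) (w (k+1))) : ∃ z : ℤ, windN w m x = 2 * Real.pi * z := by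
  have hne : ∀ k ≤ m, w k - x ≠ 0 := by
    intro k hk h1
    rw [sub_eq_zero] at h1
    rcases hk.lt_or_eq with h2 | h2
    · apply h k h2
      rw [← h1]; exact left_mem_segment ℝ _ _
    · apply h0
      rw [← h1, h2, hm]
  have hp := prod_tele (fun k => w k - x) m hne
  simp only [hm] at hp
  rw [div_self (hne 0 (by omega))] at hp
  have h1 : Complex.exp ((windN w m x : ℂ) * Complex.I) = 1 := by
    unfold windN
    push_cast
    rw [Finset.sum_mul, Complex.exp_sum]
    have h2 : ∏ k ∈ Finset.range m, ‖(w (k+1) - x) / (w k - x)‖ = 1 := by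
      rw [← norm_prod, hp]; simp
    have h3 : ((∏ k ∈ Finset.range m, ‖(w (k+1) - x) / (w k - x)‖ : ℝ) : ℂ) *
      ∏ k ∈ Finset.range m, Complex.exp ((Complex.arg ((w (k+1) - x) / (w k - x)) : ℂ) * Complex.I) = 1 := by
      push_cast
      rw [← Finset.prod_mul_distrib]
      conv_rhs => rw [← hp]
      apply Finset.prod_congr rfl
      intro k _
      have := Complex.norm_mul_exp_arg_mul_I ((w (k+1) - x) / (w k - x))
      simpa using this
    rw [h2] at h3
    simpa using h3
  rw [Complex.exp_eq_one_iff] at h1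
  obtain ⟨z, hz⟩ := h1
  refine ⟨z, ?_⟩
  have h4 := congrArg Complex.im hz
  simp at h4
  linarith

lemma windN_const {w : ℕ → ℂ} {m : ℕ} (hm : w m = w 0) {D : Set ℂ} (hD : IsPreconnected D)
    (h0 : w 0 ∉ D)
    (h : ∀ k < m, Disjoint D (segment ℝ (w k) (w (k+1)))) {x y : ℂ} (hx : x ∈ D) (hy : y ∈ D) :
    windN w m x = windN w m y := by
  have hint : ∀ z ∈ D, ∃ j : ℤ, windN w m z = 2 * Real.pi * j := fun z hz =>
    windN_int hm (fun e => h0 (e ▸ hz)) (fun k hk hh => Set.disjoint_left.1 (h k hk) hz hh)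
  have hc : ContinuousOn (windN w m) D := by
    intro z hz
    apply ContinuousAt.continuousWithinAt
    unfold windN
    apply tendsto_finsetSum
    intro k hk
    exact term_cont (Set.disjoint_left.1 (h k (Finset.mem_range.1 hk)) hz)
  have key : ∀ x ∈ D, ∀ y ∈ D, ¬ windN w m x < windN w m y := by
    intro x hx y hy hlt
    obtain ⟨i, hi⟩ := hint x hx
    obtain ⟨j, hj⟩ := hint y hy
    have hpi := Real.pi_pos
    have hij : i < j := by
      rw [hi, hj] at hlt
      have : (i : ℝ) < j := by
        by_contra hc; push Not at hc
        nlinarith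
      exact_mod_cast this
    have hij' : (i : ℝ) + 1 ≤ j := by exact_mod_cast hij
    have := hD.intermediate_value hx hy hc
    have hmem : 2 * Real.pi * i + Real.pi ∈ Set.Icc (windN w m x) (windN w m y) := by
      constructor
      · rw [hi]; linarith
      · rw [hj]; nlinarith
    obtain ⟨z, hz, hz'⟩ := this hmem
    obtain ⟨l, hl⟩ := hint z hz
    rw [hl] at hz'
    have : Real.pi * (2 * l) = Real.pi * (2 * i + 1) := by linarith
    have := mul_left_cancel₀ hpi.ne' this
    have : (2 * l : ℤ) = 2 * i + 1 := by exact_mod_cast this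
    omega
  exact le_antisymm (not_lt.1 (key y hy x hx)) (not_lt.1 (key x hx y hy))

open Filter Topology in
lemma windN_jump {w : ℕ → ℂ} {m k : ℕ} (hk : k < m) {l : ℝ} (hl0 : 0 < l) (hl1 : l < 1)
    (hne : w k ≠ w (k+1)) {a : ℂ} (ha : a = w k + l * (w (k+1) - w k))
    (h : ∀ j < m, j ≠ k → a ∉ segment ℝ (w j) (w (j+1))) (c : ℝ)
    (hc : ∀ᶠ e : ℝ in 𝓝[≠] (0:ℝ), windN w m (a + e * Complex.I * (w (k+1) - w k)) = c) : False := by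
  set R : ℂ → ℝ := fun x => ∑ j ∈ (Finset.range m).erase k, Complex.arg ((w (j+1) - x) / (w j - x)) with hR
  have hsplit : ∀ x, windN w m x = Complex.arg ((w (k+1) - x) / (w k - x)) + R x := by
    intro x
    unfold windN
    rw [hR, Finset.add_sum_erase _ (fun j => Complex.arg ((w (j+1) - x) / (w j - x))) (Finset.mem_range.2 hk)]
  have hRc : ContinuousAt R a := by
    apply tendsto_finsetSum
    intro j hj
    rw [Finset.mem_erase, Finset.mem_range] at hj
    exact term_cont (h j hj.2 hj.1)
  have hd : w (k+1) - w k ≠ 0 := sub_ne_zero.2 hne.symm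
  have hratio : ∀ e : ℝ, e ≠ 0 → (w (k+1) - (a + e * Complex.I * (w (k+1) - w k))) / (w k - (a + e * Complex.I * (w (k+1) - w k)))
      = (((-(l*(1-l)) + e^2) / (l^2+e^2) : ℝ) : ℂ) + ((e / (l^2+e^2) : ℝ) : ℂ) * Complex.I := by
    intro e he
    have h1 : w (k+1) - (a + e * Complex.I * (w (k+1) - w k)) = (w (k+1) - w k) * (1 - l - e * Complex.I) := by
      rw [ha]; ring
    have h2 : w k - (a + e * Complex.I * (w (k+1) - w k)) = (w (k+1) - w k) * (- l - e * Complex.I) := by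
      rw [ha]; ring
    rw [h1, h2, mul_div_mul_left _ _ hd]
    have h3 : (-(l:ℂ) - e * Complex.I) ≠ 0 := by
      intro h0
      have := congrArg Complex.im h0
      simp at this
      exact he this
    have h4 : ((l:ℂ)^2 + (e:ℂ)^2) ≠ 0 := by
      have : l^2+e^2 ≠ 0 := by positivity
      exact_mod_cast this
    push_cast
    rw [div_eq_iff h3]
    field_simp
    have hI : Complex.I ^ 2 = -1 := Complex.I_sq
    linear_combination ((e:ℂ)^2) * hI
  have hcont : Tendsto (fun e : ℝ => R (a + e * Complex.I * (w (k+1) - w k))) (𝓝 0) (𝓝 (R a)) := by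
    have : ContinuousAt (fun e : ℝ => a + e * Complex.I * (w (k+1) - w k)) 0 := by fun_prop
    have h2 : Tendsto (fun e : ℝ => a + e * Complex.I * (w (k+1) - w k)) (𝓝 0) (𝓝 a) := by
      have h3 := this.tendsto
      simpa using h3
    exact hRc.tendsto.comp h2
  have hpi := Real.pi_pos
  have hnear : ∀ᶠ e : ℝ in 𝓝 (0:ℝ), |R (a + e * Complex.I * (w (k+1) - w k)) - R a| < Real.pi / 2 := by
    have := Metric.tendsto_nhds.1 hcont (Real.pi/2) (by positivity)
    simpa [Real.dist_eq] using this
  have hsm : ∀ᶠ e : ℝ in 𝓝 (0:ℝ), e^2 < l*(1-l) := by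
    have : ContinuousAt (fun e:ℝ => e^2) 0 := by fun_prop
    apply this.eventually_lt_const
    have : 0 < l * (1-l) := mul_pos hl0 (by linarith)
    simpa using this
  rw [eventually_nhdsWithin_iff] at hc
  obtain ⟨δ, hδ, hb⟩ := Metric.eventually_nhds_iff.1 (hc.and (hnear.and hsm))
  have q1 := @hb (δ/2) (by rw [Real.dist_eq]; simp; rw [abs_of_pos (by linarith)]; linarith)
  have q2 := @hb (-(δ/2)) (by rw [Real.dist_eq]; simp; rw [abs_of_pos (by linarith)]; linarith)
  have n1 : δ/2 ≠ 0 := by positivity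
  have n2 : -(δ/2) ≠ 0 := by simpa using n1
  have arg1 : Real.pi / 2 < Complex.arg ((w (k+1) - (a + (δ/2:ℝ) * Complex.I * (w (k+1) - w k))) / (w k - (a + (δ/2:ℝ) * Complex.I * (w (k+1) - w k)))) := by
    rw [hratio _ n1]
    set z := ((((-(l*(1-l)) + (δ/2)^2) / (l^2+(δ/2)^2) : ℝ) : ℂ) + (((δ/2) / (l^2+(δ/2)^2) : ℝ) : ℂ) * Complex.I) with hz
    have hre : z.re < 0 := by
      rw [hz]; simp only [Complex.add_re, Complex.ofReal_re, Complex.mul_re, Complex.I_re, Complex.ofReal_im, Complex.I_im]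
      have : (-(l * (1 - l)) + (δ / 2) ^ 2) / (l ^ 2 + (δ / 2) ^ 2) < 0 :=
        div_neg_of_neg_of_pos (by linarith [q1.2.2]) (by positivity)
      linarith
    have him : 0 ≤ z.im := by
      rw [hz]; simp only [Complex.add_im, Complex.ofReal_re, Complex.mul_im, Complex.I_re, Complex.ofReal_im, Complex.I_im]
      have : 0 ≤ (δ / 2)  / (l ^ 2 + (δ / 2) ^ 2) := by positivity
      linarith
    by_contra hcon
    have := Complex.abs_arg_le_pi_div_two_iff.1 (abs_le.2 ⟨by linarith [Complex.arg_nonneg_iff.2 him], not_lt.1 hcon⟩)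
    linarith
  have arg2 : Complex.arg ((w (k+1) - (a + (-(δ/2):ℝ) * Complex.I * (w (k+1) - w k))) / (w k - (a + (-(δ/2):ℝ) * Complex.I * (w (k+1) - w k)))) < - (Real.pi / 2) := by
    rw [hratio _ n2]
    set z := ((((-(l*(1-l)) + (-(δ/2))^2) / (l^2+(-(δ/2))^2) : ℝ) : ℂ) + (((-(δ/2)) / (l^2+(-(δ/2))^2) : ℝ) : ℂ) * Complex.I) with hz
    have hre : z.re < 0 := by
      rw [hz]; simp only [Complex.add_re, Complex.ofReal_re, Complex.mul_re, Complex.I_re, Complex.ofReal_im, Complex.I_im]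
      have : (-(l * (1 - l)) + (-(δ / 2)) ^ 2) / (l ^ 2 + (-(δ / 2)) ^ 2) < 0 :=
        div_neg_of_neg_of_pos (by linarith [q2.2.2]) (by positivity)
      linarith
    have him : z.im < 0 := by
      rw [hz]; simp only [Complex.add_im, Complex.ofReal_re, Complex.mul_im, Complex.I_re, Complex.ofReal_im, Complex.I_im]
      have : (-(δ / 2))  / (l ^ 2 + (-(δ / 2)) ^ 2) < 0 :=
        div_neg_of_neg_of_pos (by linarith) (by positivity)
      linarith
    by_contra hcon
    have := Complex.abs_arg_le_pi_div_two_iff.1 (abs_le.2 ⟨not_lt.1 hcon, by linarith [Complex.arg_neg_iff.2 him]⟩)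
    linarith
  have e1 := q1.1 n1
  have e2 := q2.1 n2
  rw [hsplit] at e1 e2
  have b1 := abs_lt.1 q1.2.1
  have b2 := abs_lt.1 q2.2.1
  linarith [b1.1, b1.2, b2.1, b2.2]

def crL (e x : ℂ) : ℝ := e.re * x.im - e.im * x.re

lemma crL_add (e x y : ℂ) : crL e (x + y) = crL e x + crL e y := by simp [crL]; ring
lemma crL_sub (e x y : ℂ) : crL e (x - y) = crL e x - crL e y := by simp [crL]; ring
lemma crL_smul (e : ℂ) (t : ℝ) (y : ℂ) : crL e (t * y) = t * crL e y := by simp [crL]; ring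
lemma crL_swap (e y : ℂ) : crL e y = - crL y e := by simp [crL]; ring
lemma crL_self (e : ℂ) : crL e e = 0 := by simp [crL]; ring

lemma crL_lin (e : ℂ) : IsLinearMap ℝ (crL e) :=
  ⟨crL_add e, fun t y => by rw [Complex.real_smul, crL_smul, smul_eq_mul]⟩

lemma collin {e y : ℂ} (he : e ≠ 0) (h : crL e y = 0) : ∃ t : ℝ, y = t * e := by
  have hn : e.re ^ 2 + e.im ^ 2 ≠ 0 := by
    have := (Complex.normSq_pos.2 he).ne'
    rw [Complex.normSq_apply] at this
    intro h0; apply this; linarith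
  refine ⟨(y.re * e.re + y.im * e.im) / (e.re ^ 2 + e.im ^ 2), ?_⟩
  unfold crL at h
  apply Complex.ext
  · simp only [Complex.mul_re, Complex.ofReal_re, Complex.ofReal_im]
    field_simp
    linear_combination (-e.im) * h
  · simp only [Complex.mul_im, Complex.ofReal_re, Complex.ofReal_im]
    field_simp
    linear_combination (e.re) * h

lemma mem_seg_iff {z q x : ℂ} : x ∈ segment ℝ z q ↔ ∃ t : ℝ, 0 ≤ t ∧ t ≤ 1 ∧ x = z + t * (q - z) := by
  rw [segment_eq_image']
  constructor
  · rintro ⟨t, ht, rfl⟩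
    exact ⟨t, ht.1, ht.2, by simp⟩
  · rintro ⟨t, h0, h1, rfl⟩
    exact ⟨t, ⟨h0, h1⟩, by simp⟩

lemma mem_seg_of {z q x : ℂ} {r t : ℝ} (hr : r ≤ ‖q - z‖) (hx : x ∈ Metric.ball z r) (ht : 0 ≤ t)
    (h : x - z = t * (q - z)) : x ∈ segment ℝ z q := by
  rw [mem_seg_iff]
  refine ⟨t, ht, ?_, by rw [← h]; ring⟩
  rw [mem_ball_iff_norm, h, norm_mul, Complex.norm_real, Real.norm_of_nonneg ht] at hx
  by_contra hc
  push Not at hc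
  have : 0 ≤ ‖q - z‖ := norm_nonneg _
  nlinarith

lemma sector_pos {z q1 q2 : ℂ} {r : ℝ} (hr : 0 < r) (hr1 : r ≤ ‖q1 - z‖) (hr2 : r ≤ ‖q2 - z‖)
    (hc : 0 < crL (q1 - z) (q2 - z)) :
    ∃ A B : Set ℂ, IsPreconnected A ∧ IsPreconnected B ∧
      Metric.ball z r \ (segment ℝ z q1 ∪ segment ℝ z q2) = A ∪ B := by
  set e := q1 - z with he
  set f := q2 - z with hf
  have he0 : e ≠ 0 := norm_pos_iff.1 (by linarith)
  have hf0 : f ≠ 0 := norm_pos_iff.1 (by linarith)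
  refine ⟨(Metric.ball z r ∩ {x | crL e z < crL e x}) ∩ {x | crL f x < crL f z},
    (Metric.ball z r ∩ {x | crL e x < crL e z}) ∪ (Metric.ball z r ∩ {x | crL f z < crL f x}),
    ?_, ?_, ?_⟩
  · exact (((convex_ball z r).inter (convex_halfSpace_gt (crL_lin e) _)).inter
      (convex_halfSpace_lt (crL_lin f) _)).isPreconnected
  · have hd : 0 < r / (2 * (‖e + f‖ + 1)) := by positivity
    set d := r / (2 * (‖e + f‖ + 1)) with hdd
    have hb : z + (((-d : ℝ)) : ℂ) * (e + f) ∈ Metric.ball z r := by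
      rw [mem_ball_iff_norm, add_sub_cancel_left, norm_mul, Complex.norm_real, norm_neg,
        Real.norm_of_nonneg hd.le, hdd, div_mul_eq_mul_div, div_lt_iff₀ (by positivity)]
      nlinarith [norm_nonneg (e + f)]
    refine IsPreconnected.union (z + (((-d : ℝ)) : ℂ) * (e + f)) ⟨hb, ?_⟩ ⟨hb, ?_⟩ ?_ ?_
    · simp only [Set.mem_ofPred_eq, crL_add, crL_smul, crL_self]
      nlinarith
    · simp only [Set.mem_ofPred_eq, crL_add, crL_smul, crL_self]
      rw [crL_swap f e]
      nlinarith
    · exact ((convex_ball z r).inter (convex_halfSpace_lt (crL_lin e) _)).isPreconnected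
    · exact ((convex_ball z r).inter (convex_halfSpace_gt (crL_lin f) _)).isPreconnected
  · ext x
    constructor
    · rintro ⟨hx, hn⟩
      rw [Set.mem_union, not_or] at hn
      by_contra hcon
      simp only [Set.mem_union, Set.mem_inter_iff, hx, true_and, Set.mem_ofPred_eq, not_or, not_and, not_lt] at hcon
      obtain ⟨h1, h2, h3⟩ := hcon
      rcases h2.eq_or_lt with h4 | h4
      · obtain ⟨t, ht⟩ := collin he0 (y := x - z) (by rw [crL_sub]; linarith)
        apply hn.1
        refine mem_seg_of hr1 hx ?_ ht
        have h5 : crL f x - crL f z ≤ 0 := by linarith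
        rw [← crL_sub, ht, crL_smul, crL_swap] at h5
        by_contra h6
        push Not at h6
        nlinarith
      · have h7 := le_antisymm (h1 h4) h3
        obtain ⟨t, ht⟩ := collin hf0 (y := x - z) (by rw [crL_sub]; linarith)
        apply hn.2
        refine mem_seg_of hr2 hx ?_ ht
        have h5 : 0 < crL e x - crL e z := by linarith
        rw [← crL_sub, ht, crL_smul] at h5
        by_contra h6
        push Not at h6
        nlinarith
    · intro hx
      have hxb : x ∈ Metric.ball z r := by
        rcases hx with hx | hx | hx
        · exact hx.1.1
        · exact hx.1
        · exact hx.1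
      refine ⟨hxb, ?_⟩
      simp only [Set.mem_union, Set.mem_inter_iff, hxb, true_and, Set.mem_ofPred_eq] at hx
      rintro (hs | hs)
      · obtain ⟨t, h0, h1, rfl⟩ := mem_seg_iff.1 hs
        rw [← he] at hx
        simp only [crL_add, crL_smul, crL_self] at hx
        rw [crL_swap f e] at hx
        rcases hx with ⟨h2, h3⟩ | h2 | h2 <;> nlinarith
      · obtain ⟨t, h0, h1, rfl⟩ := mem_seg_iff.1 hs
        rw [← hf] at hx
        simp only [crL_add, crL_smul, crL_self] at hx
        rcases hx with ⟨h2, h3⟩ | h2 | h2 <;> nlinarith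

lemma sector {z q1 q2 : ℂ} {r : ℝ} (hr : 0 < r) (hr1 : r ≤ ‖q1 - z‖) (hr2 : r ≤ ‖q2 - z‖)
    (hne : ∀ s t : ℝ, 0 < s → s < 1 → 0 < t → t < 1 → z + s * (q1 - z) ≠ z + t * (q2 - z)) :
    ∃ A B : Set ℂ, IsPreconnected A ∧ IsPreconnected B ∧
      Metric.ball z r \ (segment ℝ z q1 ∪ segment ℝ z q2) = A ∪ B := by
  rcases lt_trichotomy (crL (q1 - z) (q2 - z)) 0 with hc | hc | hc
  · rw [Set.union_comm]
    refine sector_pos hr hr2 hr1 ?_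
    rw [crL_swap]; linarith
  · have he0 : q1 - z ≠ 0 := norm_pos_iff.1 (by linarith)
    have hf0 : q2 - z ≠ 0 := norm_pos_iff.1 (by linarith)
    obtain ⟨l, hl⟩ := collin he0 hc
    have hl0 : l < 0 := by
      by_contra h
      push Not at h
      have hl1 : 0 < l := by
        rcases h.eq_or_lt with h | h
        · rw [← h] at hl; simp at hl; exact absurd hl hf0
        · exact h
      apply hne (l / (2 * (1 + l))) (1 / (2 * (1 + l))) (by positivity)
        (by rw [div_lt_one (by positivity)]; linarith) (by positivity)
        (by rw [div_lt_one (by positivity)]; linarith)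
      rw [hl]
      push_cast
      ring
    refine ⟨Metric.ball z r ∩ {x | crL (q1 - z) z < crL (q1 - z) x},
      Metric.ball z r ∩ {x | crL (q1 - z) x < crL (q1 - z) z}, ?_, ?_, ?_⟩
    · exact ((convex_ball z r).inter (convex_halfSpace_gt (crL_lin _) _)).isPreconnected
    · exact ((convex_ball z r).inter (convex_halfSpace_lt (crL_lin _) _)).isPreconnected
    · ext x
      constructor
      · rintro ⟨hx, hn⟩
        rw [Set.mem_union, not_or] at hn
        rcases lt_trichotomy (crL (q1 - z) x) (crL (q1 - z) z) with h | h | h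
        · exact Or.inr ⟨hx, h⟩
        · exfalso
          obtain ⟨t, ht⟩ := collin he0 (y := x - z) (by rw [crL_sub]; linarith)
          rcases le_total 0 t with h0 | h0
          · exact hn.1 (mem_seg_of hr1 hx h0 ht)
          · refine hn.2 (mem_seg_of (t := t / l) hr2 hx (div_nonneg_of_nonpos h0 hl0.le) ?_)
            have : (l : ℂ) ≠ 0 := by exact_mod_cast hl0.ne
            rw [ht, hl]; push_cast; field_simp
        · exact Or.inl ⟨hx, h⟩
      · intro hx
        have hxb : x ∈ Metric.ball z r := by
          rcases hx with hx | hx <;> exact hx.1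
        refine ⟨hxb, ?_⟩
        simp only [Set.mem_union, Set.mem_inter_iff, hxb, true_and, Set.mem_ofPred_eq] at hx
        have : crL (q1 - z) x ≠ crL (q1 - z) z := by
          rcases hx with h | h
          · exact h.ne'
          · exact h.ne
        rintro (hs | hs)
        · obtain ⟨t, h0, h1, rfl⟩ := mem_seg_iff.1 hs
          apply this
          simp only [crL_add, crL_smul, crL_self]; ring
        · obtain ⟨t, h0, h1, rfl⟩ := mem_seg_iff.1 hs
          apply this
          rw [hl]
          simp only [crL_add, crL_smul, crL_self]; ring
  · exact sector_pos hr hr1 hr2 hc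

open Filter Topology

lemma germ_const {S D : Set ℂ} {W : ℂ → ℝ} (hS : IsPreconnected S) (hcl : S ⊆ closure D)
    (h : ∀ x ∈ S, ∃ m, ∀ᶠ y in 𝓝[D] x, W y = m) {x y : ℂ} (hx : x ∈ S) (hy : y ∈ S) :
    ∃ m, (∀ᶠ z in 𝓝[D] x, W z = m) ∧ ∀ᶠ z in 𝓝[D] y, W z = m := by
  obtain ⟨m, hm⟩ := h x hx
  refine ⟨m, hm, ?_⟩
  have hop : ∀ m : ℝ, IsOpen {x : ℂ | ∀ᶠ z in 𝓝[D] x, W z = m} := by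
    intro m
    rw [isOpen_iff_mem_nhds]
    intro z hz
    exact (eventually_eventually_nhds.2 (eventually_nhdsWithin_iff.1 hz)).mono
      (fun a ha => eventually_nhdsWithin_iff.2 ha)
  have hV : IsOpen (⋃ m' ∈ {m' : ℝ | m' ≠ m}, {x : ℂ | ∀ᶠ z in 𝓝[D] x, W z = m'}) :=
    isOpen_biUnion (fun m' _ => hop m')
  have hdis : S ∩ ({x : ℂ | ∀ᶠ z in 𝓝[D] x, W z = m} ∩
      ⋃ m' ∈ {m' : ℝ | m' ≠ m}, {x : ℂ | ∀ᶠ z in 𝓝[D] x, W z = m'}) = ∅ := by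
    rw [Set.eq_empty_iff_forall_notMem]
    rintro z ⟨hz, h1, h2⟩
    simp only [Set.mem_iUnion] at h2
    obtain ⟨m', hm', h2⟩ := h2
    have : (𝓝[D] z).NeBot := mem_closure_iff_nhdsWithin_neBot.1 (hcl hz)
    have h1' : ∀ᶠ z in 𝓝[D] z, W z = m := h1
    have h2' : ∀ᶠ z in 𝓝[D] z, W z = m' := h2
    obtain ⟨q, q1, q2⟩ := (h1'.and h2').exists
    exact hm' (q2.symm.trans q1)
  have hcov : S ⊆ {x : ℂ | ∀ᶠ z in 𝓝[D] x, W z = m} ∪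
      ⋃ m' ∈ {m' : ℝ | m' ≠ m}, {x : ℂ | ∀ᶠ z in 𝓝[D] x, W z = m'} := by
    intro z hz
    obtain ⟨m', hm'⟩ := h z hz
    by_cases hc : m' = m
    · left; rw [hc] at hm'; exact hm'
    · right; simp only [Set.mem_iUnion]; exact ⟨m', hc, hm'⟩
  rcases (isPreconnected_iff_subset_of_disjoint.1 hS) _ _ (hop m) hV hcov hdis with h1 | h1
  · exact h1 hy
  · exfalso
    have : x ∈ S ∩ ({x : ℂ | ∀ᶠ z in 𝓝[D] x, W z = m} ∩
      ⋃ m' ∈ {m' : ℝ | m' ≠ m}, {x : ℂ | ∀ᶠ z in 𝓝[D] x, W z = m'}) := ⟨hx, hm, h1 hx⟩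
    rw [hdis] at this
    exact this

/-! ### Parametrization -/

noncomputable def gam (u : ℕ → ℂ) (N : ℕ) (τ : ℝ) : ℂ :=
  u 0 + ∑ k ∈ Finset.range N, ((max 0 (min (τ - k) 1) : ℝ) : ℂ) * (u (k+1) - u k)

lemma gam_continuous (u : ℕ → ℂ) (N : ℕ) : Continuous (gam u N) := by
  unfold gam
  fun_prop

lemma gam_full (u : ℕ → ℂ) (N : ℕ) (τ : ℝ) (h : (N : ℝ) ≤ τ) : gam u N τ = u N := by
  induction N with
  | zero => simp [gam]
  | succ N ih =>
    push_cast at h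
    have := ih (by linarith)
    unfold gam at this ⊢
    rw [Finset.sum_range_succ, ← add_assoc, this, min_eq_right (by linarith), max_eq_right (by linarith)]
    push_cast; ring

lemma gam_on (u : ℕ → ℂ) (N k : ℕ) (hk : k < N) (τ : ℝ) (h1 : (k:ℝ) ≤ τ) (h2 : τ ≤ k + 1) :
    gam u N τ = u k + ((τ - k : ℝ) : ℂ) * (u (k+1) - u k) := by
  induction N, (hk : k + 1 ≤ N) using Nat.le_induction with
  | base =>
    have := gam_full u k τ h1
    unfold gam at this ⊢
    rw [Finset.sum_range_succ, ← add_assoc, this, min_eq_left (by linarith), max_eq_right (by linarith)]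
  | succ N hN ih =>
    have := ih
    unfold gam at this ⊢
    have hN' : (k:ℝ) + 1 ≤ N := by exact_mod_cast hN
    rw [Finset.sum_range_succ, ← add_assoc, this, min_eq_left (by linarith), max_eq_left (by linarith)]
    simp

/-- The simple closed polygon hypothesis in parametrized form. -/
structure SimpPoly (n : ℕ) (u : ℕ → ℂ) : Prop where
  two : 2 ≤ n
  per : ∀ k, u (k + n) = u k
  inj : ∀ (k l : ℕ) (x y : ℝ), 0 ≤ x → x < 1 → 0 ≤ y → y < 1 →
    u k + x * (u (k+1) - u k) = u l + y * (u (l+1) - u l) → k ≡ l [MOD n] ∧ x = y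

namespace SimpPoly
variable {n : ℕ} {u : ℕ → ℂ} 

lemma congr (h : SimpPoly n u) {k l : ℕ} (hkl : k ≡ l [MOD n]) : u k = u l := by
  have hp : Function.Periodic u n := h.per
  rw [← hp.map_mod_nat k, ← hp.map_mod_nat l, hkl]

lemma not_succ (h : SimpPoly n u) (k : ℕ) : ¬ k ≡ k + 1 [MOD n] := by
  intro hk
  have := (Nat.modEq_iff_dvd' (Nat.le_succ k)).1 hk
  simp at this
  have := h.two
  omega

lemma ne (h : SimpPoly n u) (k : ℕ) : u k ≠ u (k+1) := by
  intro hk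
  have := (h.inj k (k+1) 0 0 le_rfl one_pos le_rfl one_pos (by simpa using hk)).1
  exact h.not_succ k this

lemma gam_inj (h : SimpPoly n u) {τ σ : ℝ} (h1 : 0 ≤ τ) (h2 : τ < 2 * n) (h3 : 0 ≤ σ) (h4 : σ < 2 * n)
    (h5 : |τ - σ| < n) (he : gam u (2*n) τ = gam u (2*n) σ) : τ = σ := by
  have a1 := Nat.floor_le h1
  have a2 := Nat.lt_floor_add_one τ
  have b1 := Nat.floor_le h3
  have b2 := Nat.lt_floor_add_one σ
  have a3 : ⌊τ⌋₊ < 2 * n := by rw [Nat.floor_lt h1]; exact_mod_cast h2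
  have b3 : ⌊σ⌋₊ < 2 * n := by rw [Nat.floor_lt h3]; exact_mod_cast h4
  rw [gam_on u _ _ a3 τ a1 a2.le, gam_on u _ _ b3 σ b1 b2.le] at he
  obtain ⟨c1, c2⟩ := h.inj _ _ _ _ (by linarith) (by linarith) (by linarith) (by linarith) he
  have c3 := Nat.modEq_iff_dvd.1 c1
  obtain ⟨c, hc⟩ := c3
  have h6 : σ - τ = n * c := by
    have : ((⌊σ⌋₊ : ℝ) - ⌊τ⌋₊) = n * c := by exact_mod_cast hc
    linarith
  have hn : (0:ℝ) < n := by have := h.two; positivity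
  rw [abs_sub_comm, h6, abs_mul, abs_of_pos hn] at h5
  have h7 : |(c:ℝ)| < 1 := by
    by_contra hcon
    push Not at hcon
    nlinarith
  have h8 : |c| < 1 := by exact_mod_cast h7
  have h9 : c = 0 := Int.abs_lt_one_iff.1 h8
  rw [h9] at h6
  simp at h6
  linarith

lemma gam_per (h : SimpPoly n u) {τ : ℝ} (h1 : 0 ≤ τ) (h2 : τ < n) :
    gam u (2*n) (τ + n) = gam u (2*n) τ := by
  have a1 := Nat.floor_le h1
  have a2 := Nat.lt_floor_add_one τ
  have a3 : ⌊τ⌋₊ < n := by rw [Nat.floor_lt h1]; exact_mod_cast h2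
  rw [gam_on u _ ⌊τ⌋₊ (by omega) τ a1 a2.le, gam_on u _ (⌊τ⌋₊ + n) (by omega) (τ + n) (by push_cast; linarith) (by push_cast; linarith)]
  have e : ⌊τ⌋₊ + n + 1 = (⌊τ⌋₊ + 1) + n := by ring
  rw [e, h.per, h.per]
  push_cast
  ring

lemma seg_eq {k l : ℕ} (h : SimpPoly n u) (hkl : k ≡ l [MOD n]) :
    segment ℝ (u k) (u (k+1)) = segment ℝ (u l) (u (l+1)) := by
  rw [h.congr hkl, h.congr (hkl.add_right 1)]
end SimpPoly
namespace SimpPoly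
variable {n : ℕ} {u : ℕ → ℂ} 
lemma gam_surj (h : SimpPoly n u) {k : ℕ} {z : ℂ} (hz : z ∈ segment ℝ (u k) (u (k+1))) :
    ∃ τ : ℝ, 0 ≤ τ ∧ τ ≤ n ∧ gam u (2*n) τ = z := by
  have hn : 0 < n := by have := h.two; omega
  rw [h.seg_eq (Nat.mod_modEq k n).symm] at hz
  obtain ⟨t, h0, h1, rfl⟩ := mem_seg_iff.1 hz
  have hk := Nat.mod_lt k hn
  set j := k % n
  have hk' : (j:ℝ) + 1 ≤ n := by exact_mod_cast hk
  refine ⟨j + t, by positivity, by linarith, ?_⟩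
  rw [gam_on u _ j (by omega) _ (by linarith) (by linarith)]
  simp

/-- the curve -/
def J (u : ℕ → ℂ) : Set ℂ := ⋃ k : ℕ, segment ℝ (u k) (u (k+1))

lemma gam_mem (h : SimpPoly n u) {τ : ℝ} (h1 : 0 ≤ τ) (h2 : τ < 2 * n) : gam u (2*n) τ ∈ J u := by
  have a1 := Nat.floor_le h1
  have a2 := Nat.lt_floor_add_one τ
  have a3 : ⌊τ⌋₊ < 2 * n := by rw [Nat.floor_lt h1]; exact_mod_cast h2
  rw [gam_on u _ ⌊τ⌋₊ a3 τ a1 a2.le]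
  refine Set.mem_iUnion.2 ⟨⌊τ⌋₊, mem_seg_iff.2 ⟨_, by linarith, by linarith, rfl⟩⟩

lemma J_eq (h : SimpPoly n u) : J u = gam u (2*n) '' Set.Icc (0:ℝ) n := by
  have hn : (0:ℝ) < n := by have := h.two; positivity
  apply Set.Subset.antisymm
  · intro z hz
    obtain ⟨k, hk⟩ := Set.mem_iUnion.1 hz
    obtain ⟨τ, h1, h2, h3⟩ := h.gam_surj hk
    exact ⟨τ, ⟨h1, h2⟩, h3⟩
  · rintro _ ⟨τ, ⟨h1, h2⟩, rfl⟩
    exact h.gam_mem h1 (by linarith)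

lemma J_pre (h : SimpPoly n u) : IsPreconnected (J u) := by
  rw [h.J_eq]
  exact isPreconnected_Icc.image _ (gam_continuous _ _).continuousOn

lemma seg_closed (a b : ℂ) : IsClosed (segment ℝ a b) := by
  rw [segment_eq_image_lineMap]
  exact (isCompact_Icc.image AffineMap.lineMap_continuous).isClosed

lemma J_near (h : SimpPoly n u) (z : ℂ) : ∃ ε > 0, ∀ y ∈ J u, y ∈ Metric.ball z ε →
    ∃ l, z ∈ segment ℝ (u l) (u (l+1)) ∧ y ∈ segment ℝ (u l) (u (l+1)) := by
  have hn : 0 < n := by have := h.two; omega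
  have hF : IsClosed (⋃ l ∈ {l : ℕ | l < n ∧ z ∉ segment ℝ (u l) (u (l+1))}, segment ℝ (u l) (u (l+1))) := by
    apply Set.Finite.isClosed_biUnion
    · exact (Set.finite_lt_nat n).subset (fun l hl => hl.1)
    · intro l _; exact seg_closed _ _
  have hz : z ∈ (⋃ l ∈ {l : ℕ | l < n ∧ z ∉ segment ℝ (u l) (u (l+1))}, segment ℝ (u l) (u (l+1)))ᶜ := by
    intro hz
    simp only [Set.mem_iUnion] at hz
    obtain ⟨l, hl, hl'⟩ := hz
    exact hl.2 hl'
  obtain ⟨ε, hε, hb⟩ := Metric.isOpen_iff.1 hF.isOpen_compl z hz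
  refine ⟨ε, hε, ?_⟩
  intro y hy hyb
  obtain ⟨k, hk⟩ := Set.mem_iUnion.1 hy
  rw [h.seg_eq (Nat.mod_modEq k n).symm] at hk
  refine ⟨k % n, ?_, hk⟩
  by_contra hcon
  apply hb hyb
  simp only [Set.mem_iUnion]
  exact ⟨k % n, ⟨Nat.mod_lt k hn, hcon⟩, hk⟩

/-- edges through a point -/
lemma edges_through (h : SimpPoly n u) {k l : ℕ} {x : ℝ} (h0 : 0 ≤ x) (h1 : x < 1)
    (hz : u k + x * (u (k+1) - u k) ∈ segment ℝ (u l) (u (l+1))) :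
    k ≡ l [MOD n] ∨ (x = 0 ∧ k ≡ l + 1 [MOD n]) := by
  obtain ⟨y, y0, y1, hy⟩ := mem_seg_iff.1 hz
  rcases y1.lt_or_eq with hlt | heq
  · exact Or.inl (h.inj _ _ _ _ h0 h1 y0 hlt hy).1
  · right
    have := h.inj k (l+1) x 0 h0 h1 le_rfl one_pos (by rw [hy, heq]; push_cast; ring)
    exact ⟨this.2, this.1⟩
end SimpPoly

namespace SimpPoly
variable {n : ℕ} {u : ℕ → ℂ}

lemma local_star (h : SimpPoly n u) {z : ℂ} (hz : z ∈ J u) :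
    ∃ q1 q2 : ℂ, q1 ≠ z ∧ q2 ≠ z ∧
      (∀ s t : ℝ, 0 < s → s < 1 → 0 < t → t < 1 → z + s * (q1 - z) ≠ z + t * (q2 - z)) ∧
      segment ℝ z q1 ⊆ J u ∧ segment ℝ z q2 ⊆ J u ∧
      ∀ l, z ∈ segment ℝ (u l) (u (l+1)) → segment ℝ (u l) (u (l+1)) ⊆ segment ℝ z q1 ∪ segment ℝ z q2 := by
  have hn := h.two
  have hJ : ∀ k, segment ℝ (u k) (u (k+1)) ⊆ J u := fun k => Set.subset_iUnion (fun k => segment ℝ (u k) (u (k+1))) k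
  have hrep : ∃ (k : ℕ) (x : ℝ), 0 ≤ x ∧ x < 1 ∧ z = u (k+1) + x * (u (k+1+1) - u (k+1)) := by
    obtain ⟨k, hk⟩ := Set.mem_iUnion.1 hz
    obtain ⟨x, h0, h1, hx⟩ := mem_seg_iff.1 hk
    rcases h1.lt_or_eq with hlt | heq
    · obtain ⟨m, rfl⟩ : ∃ m, n = m + 1 := ⟨n - 1, by omega⟩
      refine ⟨k + m, x, h0, hlt, ?_⟩
      have e1 : k + m + 1 = k + (m + 1) := by ring
      have e2 : k + m + 1 + 1 = k + 1 + (m + 1) := by ring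
      rw [e2, e1, h.per, h.per, hx]
    · exact ⟨k, 0, le_rfl, one_pos, by rw [hx, heq]; push_cast; ring⟩
  obtain ⟨k, x, h0, h1, rfl⟩ := hrep
  have hne := h.ne (k+1)
  have hd : u (k+1+1) - u (k+1) ≠ 0 := sub_ne_zero.2 hne.symm
  rcases h0.eq_or_lt with hx | hx
  · subst hx
    have ez : u (k+1) + ((0:ℝ):ℂ) * (u (k+1+1) - u (k+1)) = u (k+1) := by simp
    have et := fun l => h.edges_through (k := k+1) (l := l) (x := 0) le_rfl one_pos
    rw [ez] at et ⊢
    refine ⟨u k, u (k+1+1), h.ne k, hne.symm, ?_, ?_, hJ _, ?_⟩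
    · intro s t s0 s1 t0 t1 he
      have := h.inj k (k+1) (1-s) t (by linarith) (by linarith) t0.le t1 (by rw [← he]; push_cast; ring)
      exact h.not_succ k this.1
    · rw [segment_symm]; exact hJ k
    · intro l hl
      rcases et l hl with hc | ⟨_, hc⟩
      · rw [h.seg_eq hc.symm]; exact Set.subset_union_right
      · have hc' : k ≡ l [MOD n] := Nat.ModEq.add_right_cancel' 1 hc
        rw [h.seg_eq hc'.symm, segment_symm]; exact Set.subset_union_left
  · set z := u (k+1) + (x:ℂ) * (u (k+1+1) - u (k+1)) with hzdef
    have hxc : (x:ℂ) ≠ 0 := by exact_mod_cast hx.ne'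
    have hxc1 : (1:ℂ) - x ≠ 0 := by
      have : (1:ℝ) - x ≠ 0 := by linarith
      exact_mod_cast this
    have d1 : u (k+1) - z = -(x * (u (k+1+1) - u (k+1))) := by rw [hzdef]; ring
    have d2 : u (k+1+1) - z = (1 - x) * (u (k+1+1) - u (k+1)) := by rw [hzdef]; ring
    have hzk : z ∈ segment ℝ (u (k+1)) (u (k+1+1)) := mem_seg_iff.2 ⟨x, h0, h1.le, rfl⟩
    refine ⟨u (k+1), u (k+1+1), ?_, ?_, ?_, ?_, ?_, ?_⟩
    · rw [← sub_ne_zero, d1]; exact neg_ne_zero.2 (mul_ne_zero hxc hd)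
    · rw [← sub_ne_zero, d2]; exact mul_ne_zero hxc1 hd
    · intro s t s0 s1 t0 t1 he
      rw [d1, d2] at he
      have h3 : ((s * x + t * (1 - x) : ℝ) : ℂ) * (u (k+1+1) - u (k+1)) = 0 := by
        push_cast; linear_combination -he
      have h4 := (mul_eq_zero.1 h3).resolve_right hd
      have h5 : s * x + t * (1 - x) = 0 := by exact_mod_cast h4
      nlinarith [mul_pos s0 hx, mul_pos t0 (by linarith : 0 < 1 - x)]
    · exact (convex_segment _ _).segment_subset hzk (left_mem_segment ℝ _ _) |>.trans (hJ _)
    · exact (convex_segment _ _).segment_subset hzk (right_mem_segment ℝ _ _) |>.trans (hJ _)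
    · intro l hl
      rcases h.edges_through h0 h1 hl with hc | ⟨hc, _⟩
      · rw [h.seg_eq hc.symm]
        intro y hy
        obtain ⟨t, t0, t1, rfl⟩ := mem_seg_iff.1 hy
        rcases le_total t x with htx | htx
        · left
          refine mem_seg_iff.2 ⟨(x - t) / x, div_nonneg (by linarith) h0, by rw [div_le_one hx]; linarith, ?_⟩
          rw [d1, hzdef]; push_cast; field_simp; ring
        · right
          refine mem_seg_iff.2 ⟨(t - x) / (1 - x), div_nonneg (by linarith) (by linarith), by rw [div_le_one (by linarith)]; linarith, ?_⟩
          rw [d2, hzdef]; push_cast; field_simp; ring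
      · exact absurd hc hx.ne'

lemma local_two (h : SimpPoly n u) {z : ℂ} (hz : z ∈ J u) :
    ∃ r0 > 0, ∀ r, 0 < r → r ≤ r0 → ∃ A B : Set ℂ, IsPreconnected A ∧ IsPreconnected B ∧
      Metric.ball z r \ J u = A ∪ B := by
  obtain ⟨q1, q2, n1, n2, hne, s1, s2, hl⟩ := h.local_star hz
  obtain ⟨ε, hε, hb⟩ := h.J_near z
  have p1 : 0 < ‖q1 - z‖ := norm_pos_iff.2 (sub_ne_zero.2 n1)
  have p2 : 0 < ‖q2 - z‖ := norm_pos_iff.2 (sub_ne_zero.2 n2)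
  refine ⟨min ε (min ‖q1 - z‖ ‖q2 - z‖), by positivity, ?_⟩
  intro r r0 hr
  have hr1 : r ≤ ‖q1 - z‖ := hr.trans ((min_le_right _ _).trans (min_le_left _ _))
  have hr2 : r ≤ ‖q2 - z‖ := hr.trans ((min_le_right _ _).trans (min_le_right _ _))
  have hr3 : r ≤ ε := hr.trans (min_le_left _ _)
  obtain ⟨A, B, hA, hB, hAB⟩ := sector r0 hr1 hr2 hne
  refine ⟨A, B, hA, hB, ?_⟩
  rw [← hAB]
  ext y
  constructor
  · rintro ⟨y1, y2⟩
    refine ⟨y1, fun hc => y2 ?_⟩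
    rcases hc with hc | hc
    · exact s1 hc
    · exact s2 hc
  · rintro ⟨y1, y2⟩
    refine ⟨y1, fun hc => y2 ?_⟩
    obtain ⟨l, l1, l2⟩ := hb y hc (Metric.ball_subset_ball hr3 y1)
    exact hl l l1 l2

lemma local_sides (h : SimpPoly n u) {P : Set ℂ} (hP : IsClosed P) (hcl : P = closure (interior P))
    (hfr : frontier P = J u) {z : ℂ} (hz : z ∈ J u) :
    ∃ r0 > 0, ∀ r, 0 < r → r ≤ r0 →
      IsPreconnected (Pᶜ ∩ Metric.ball z r) ∧ IsPreconnected (interior P ∩ Metric.ball z r) := by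
  obtain ⟨r0, hr0, hh⟩ := h.local_two hz
  refine ⟨r0, hr0, ?_⟩
  intro r r1 r2
  obtain ⟨A, B, hA, hB, hAB⟩ := hh r r1 r2
  have hJc : ∀ y, y ∉ J u → y ∈ interior P ∪ Pᶜ := by
    intro y hy
    by_cases hyP : y ∈ P
    · left
      by_contra hc
      apply hy
      rw [← hfr, hP.frontier_eq]
      exact ⟨hyP, hc⟩
    · right; exact hyP
  have hJP : J u ⊆ P := by rw [← hfr]; exact hP.frontier_subset
  have hJi : ∀ y ∈ J u, y ∉ interior P := by
    intro y hy
    rw [← hfr, hP.frontier_eq] at hy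
    exact hy.2
  have hsp : ∀ S : Set ℂ, IsPreconnected S → S ⊆ Metric.ball z r \ J u → S ⊆ interior P ∨ S ⊆ Pᶜ := by
    intro S hS hSs
    refine isPreconnected_iff_subset_of_disjoint.1 hS _ _ isOpen_interior hP.isOpen_compl
      (fun y hy => hJc y (hSs hy).2) ?_
    rw [Set.eq_empty_iff_forall_notMem]
    rintro y ⟨_, y1, y2⟩
    exact y2 (interior_subset y1)
  have hAs : A ⊆ Metric.ball z r \ J u := by rw [hAB]; exact Set.subset_union_left
  have hBs : B ⊆ Metric.ball z r \ J u := by rw [hAB]; exact Set.subset_union_right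
  have hzb : z ∈ Metric.ball z r := Metric.mem_ball_self r1
  have hz2 : z ∈ frontier P := by rw [hfr]; exact hz
  have hi : (Metric.ball z r ∩ interior P).Nonempty := by
    have : z ∈ closure (interior P) := hcl ▸ hJP hz
    exact mem_closure_iff.1 this _ Metric.isOpen_ball hzb
  have ho : (Metric.ball z r ∩ Pᶜ).Nonempty := by
    rw [frontier_eq_closure_inter_closure] at hz2
    exact mem_closure_iff.1 hz2.2 _ Metric.isOpen_ball hzb
  have hi' : ∀ y, y ∈ Metric.ball z r → y ∈ interior P → y ∈ A ∪ B := by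
    intro y y1 y2; rw [← hAB]; exact ⟨y1, fun hc => hJi y hc y2⟩
  have ho' : ∀ y, y ∈ Metric.ball z r → y ∈ Pᶜ → y ∈ A ∪ B := by
    intro y y1 y2; rw [← hAB]; exact ⟨y1, fun hc => y2 (hJP hc)⟩
  have fin : ∀ A B : Set ℂ, IsPreconnected A → IsPreconnected B → A ⊆ Metric.ball z r \ J u →
      B ⊆ Metric.ball z r \ J u → (∀ y, y ∈ Metric.ball z r → y ∈ interior P → y ∈ A ∪ B) →
      (∀ y, y ∈ Metric.ball z r → y ∈ Pᶜ → y ∈ A ∪ B) → A ⊆ interior P → B ⊆ Pᶜ →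
      IsPreconnected (Pᶜ ∩ Metric.ball z r) ∧ IsPreconnected (interior P ∩ Metric.ball z r) := by
    intro A B hA hB hAs hBs hi' ho' h1 h2
    have e1 : Pᶜ ∩ Metric.ball z r = B := by
      ext y
      constructor
      · rintro ⟨y1, y2⟩
        rcases ho' y y2 y1 with hy | hy
        · exact absurd (interior_subset (h1 hy)) y1
        · exact hy
      · intro hy; exact ⟨h2 hy, (hBs hy).1⟩
    have e2 : interior P ∩ Metric.ball z r = A := by
      ext y
      constructor
      · rintro ⟨y1, y2⟩
        rcases hi' y y2 y1 with hy | hy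
        · exact hy
        · exact absurd (interior_subset y1) (h2 hy)
      · intro hy; exact ⟨h1 hy, (hAs hy).1⟩
    rw [e1, e2]; exact ⟨hB, hA⟩
  rcases hsp A hA hAs with h1 | h1 <;> rcases hsp B hB hBs with h2 | h2
  · exfalso
    obtain ⟨y, y1, y2⟩ := ho
    rcases ho' y y1 y2 with hy | hy
    · exact y2 (interior_subset (h1 hy))
    · exact y2 (interior_subset (h2 hy))
  · exact fin A B hA hB hAs hBs hi' ho' h1 h2
  · exact fin B A hB hA hBs hAs (by rwa [Set.union_comm]) (by rwa [Set.union_comm]) h2 h1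
  · exfalso
    obtain ⟨y, y1, y2⟩ := hi
    rcases hi' y y1 y2 with hy | hy
    · exact h1 hy (interior_subset y2)
    · exact h2 hy (interior_subset y2)

end SimpPoly

lemma gam_seg (u : ℕ → ℂ) (N k : ℕ) (hk : k < N) {σ τ : ℝ} (h1 : (k:ℝ) ≤ σ) (h2 : σ ≤ τ) (h3 : τ ≤ k + 1) :
    segment ℝ (gam u N σ) (gam u N τ) ⊆ gam u N '' Set.Icc σ τ := by
  intro y hy
  obtain ⟨t, t0, t1, rfl⟩ := mem_seg_iff.1 hy
  have b1 : σ ≤ σ + t * (τ - σ) := by nlinarith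
  have b2 : σ + t * (τ - σ) ≤ τ := by nlinarith
  refine ⟨σ + t * (τ - σ), ⟨b1, b2⟩, ?_⟩
  rw [gam_on u N k hk σ h1 (by linarith), gam_on u N k hk τ (by linarith) h3,
    gam_on u N k hk _ (by linarith) (by linarith)]
  push_cast; ring

lemma windN_germ {w : ℕ → ℂ} {m : ℕ} (hm : w m = w 0) (hm0 : 0 < m) {D : Set ℂ} {x : ℂ} {r : ℝ} (hr : 0 < r)
    (hD : IsPreconnected (D ∩ Metric.ball x r))
    (h : ∀ k < m, Disjoint (D ∩ Metric.ball x r) (segment ℝ (w k) (w (k+1)))) :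
    ∃ c, ∀ᶠ y in 𝓝[D] x, windN w m y = c := by
  by_cases hne : (D ∩ Metric.ball x r).Nonempty
  · obtain ⟨y0, hy0⟩ := hne
    refine ⟨windN w m y0, ?_⟩
    have hmem : D ∩ Metric.ball x r ∈ 𝓝[D] x := inter_mem self_mem_nhdsWithin
      (mem_nhdsWithin_of_mem_nhds (Metric.ball_mem_nhds x hr))
    filter_upwards [hmem] with y hy
    refine windN_const hm hD ?_ h hy hy0
    intro h0
    exact Set.disjoint_left.1 (h 0 hm0) h0 (left_mem_segment ℝ _ _)
  · refine ⟨0, ?_⟩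
    have hmem : D ∩ Metric.ball x r ∈ 𝓝[D] x := inter_mem self_mem_nhdsWithin
      (mem_nhdsWithin_of_mem_nhds (Metric.ball_mem_nhds x hr))
    filter_upwards [hmem] with y hy
    exact absurd ⟨y, hy⟩ hne

namespace SimpPoly
variable {n : ℕ} {u : ℕ → ℂ}

lemma crossing (h : SimpPoly n u) {P : Set ℂ} (hP : IsClosed P) (hcl : P = closure (interior P))
    (hfr : frontier P = J u) {s a t b : ℝ} (hs : 0 ≤ s) (hsa : s < a) (hat : a < t) (htb : t < b)
    (hbs : b < s + n) (hsn : s < n) (hai : ∀ k : ℕ, a ≠ k) {p : ℂ}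
    {C : Set ℂ} (hC : IsPreconnected C) (hCP : C ⊆ P)
    (hK1 : segment ℝ (gam u (2*n) t) p ⊆ P) (hK2 : segment ℝ p (gam u (2*n) s) ⊆ P)
    (hC1 : Disjoint C (segment ℝ (gam u (2*n) t) p)) (hC2 : Disjoint C (segment ℝ p (gam u (2*n) s)))
    (ha : gam u (2*n) a ∈ C) (hb : gam u (2*n) b ∈ C) : False := by
  set γ := gam u (2*n) with hγ
  set cl : ℕ → ℝ := fun k => max s (min k t) with hcldef
  have cl_s : ∀ k, s ≤ cl k := fun k => le_max_left _ _
  have cl_t : ∀ k, cl k ≤ t := fun k => max_le (by linarith) (min_le_right _ _)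
  have cl_mono : ∀ k, cl k ≤ cl (k+1) := fun k => max_le_max le_rfl (min_le_min (by push_cast; linarith) le_rfl)
  set w : ℕ → ℂ := fun k => if k ≤ 2*n then γ (cl k) else if k = 2*n+1 then p else γ s with hw
  have hJP : J u ⊆ P := by rw [← hfr]; exact hP.frontier_subset
  have hJi : ∀ y ∈ J u, y ∉ interior P := by
    intro y hy
    rw [← hfr, hP.frontier_eq] at hy
    exact hy.2
  have w0 : w 0 = γ s := by
    simp only [hw, hcldef]
    rw [if_pos (by omega), min_eq_left (by push_cast; linarith), max_eq_left (by simpa using hs)]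
  have w2n : w (2*n) = γ t := by
    simp only [hw, hcldef]
    rw [if_pos le_rfl, min_eq_right (by push_cast; linarith), max_eq_right (by linarith)]
  have w2n1 : w (2*n+1) = p := by simp [hw]
  have w2n2 : w (2*n+2) = γ s := by simp [hw]
  have hwk : ∀ k ≤ 2*n, w k = γ (cl k) := fun k hk => by simp [hw, hk]
  have hedge : ∀ k < 2*n, segment ℝ (w k) (w (k+1)) ⊆ γ '' Set.Icc (cl k) (cl (k+1)) := by
    intro k hk
    rw [hwk k hk.le, hwk (k+1) hk]
    by_cases hkt : t ≤ k
    · have e1 : cl k = t := by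
        simp only [hcldef]; rw [min_eq_right hkt, max_eq_right (by linarith)]
      have e2 : cl (k+1) = t := le_antisymm (cl_t _) (e1 ▸ cl_mono k)
      rw [e1, e2]; simp
    · push Not at hkt
      by_cases hks : (k:ℝ) + 1 ≤ s
      · have e2 : cl (k+1) = s := by
          simp only [hcldef]; push_cast
          rw [max_eq_left ((min_le_left _ _).trans hks)]
        have e1 : cl k = s := le_antisymm (e2 ▸ cl_mono k) (cl_s _)
        rw [e1, e2]; simp
      · push Not at hks
        refine gam_seg u (2*n) k hk ?_ (cl_mono k) ?_
        · simp only [hcldef]; rw [min_eq_left hkt.le]; exact le_max_right _ _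
        · simp only [hcldef]; push_cast; exact max_le hks.le (min_le_left _ _)
  have hedgeJ : ∀ k < 2*n, segment ℝ (w k) (w (k+1)) ⊆ J u := by
    intro k hk y hy
    obtain ⟨τ, ⟨τ1, τ2⟩, rfl⟩ := hedge k hk hy
    exact h.gam_mem (by linarith [cl_s k]) (by linarith [cl_t (k+1)])
  have hcase : ∀ k < 2*n+2, k < 2*n ∨ k = 2*n ∨ k = 2*n+1 := by intro k hk; omega
  have hm : w (2*n+2) = w 0 := by rw [w2n2, w0]
  have hedgeP : ∀ k < 2*n+2, segment ℝ (w k) (w (k+1)) ⊆ P := by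
    intro k hk
    rcases hcase k hk with h1 | rfl | rfl
    · exact (hedgeJ k h1).trans hJP
    · rw [w2n, w2n1]; exact hK1
    · rw [w2n1, w2n2]; exact hK2
  have hγa : γ a ∈ J u := h.gam_mem (by linarith) (by linarith)
  have hγb : γ b ∈ J u := h.gam_mem (by linarith) (by linarith)
  obtain ⟨m1, m1a, m1b⟩ := germ_const (S := J u) (D := Pᶜ) (W := windN w (2*n+2)) h.J_pre
    (by rw [← hfr, frontier_eq_closure_inter_closure]; exact Set.inter_subset_right)
    (by
      intro x hx
      obtain ⟨r0, hr0, hh⟩ := h.local_sides hP hcl hfr hx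
      refine windN_germ hm (by omega) hr0 (hh r0 hr0 le_rfl).1 ?_
      intro k hk
      rw [Set.disjoint_left]
      rintro y ⟨y1, _⟩ y2
      exact y1 (hedgeP k hk y2)) hγa hγb
  obtain ⟨m2, m2a, m2b⟩ := germ_const (S := C) (D := interior P) (W := windN w (2*n+2)) hC
    (by rw [← hcl]; exact hCP)
    (by
      intro x hx
      have hKc : IsClosed (segment ℝ (γ t) p ∪ segment ℝ p (γ s)) := (seg_closed _ _).union (seg_closed _ _)
      have hxK : x ∈ (segment ℝ (γ t) p ∪ segment ℝ p (γ s))ᶜ := by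
        rintro (hc | hc)
        · exact Set.disjoint_left.1 hC1 hx hc
        · exact Set.disjoint_left.1 hC2 hx hc
      obtain ⟨ε, hε, hbK⟩ := Metric.isOpen_iff.1 hKc.isOpen_compl x hxK
      have hdis : ∀ r ≤ ε, ∀ k < 2*n+2, Disjoint (interior P ∩ Metric.ball x r) (segment ℝ (w k) (w (k+1))) := by
        intro r hr k hk
        rw [Set.disjoint_left]
        rintro y ⟨y1, y3⟩ y2
        have y4 := hbK (Metric.ball_subset_ball hr y3)
        rcases hcase k hk with h1 | rfl | rfl
        · exact hJi y (hedgeJ k h1 y2) y1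
        · rw [w2n, w2n1] at y2; exact y4 (Or.inl y2)
        · rw [w2n1, w2n2] at y2; exact y4 (Or.inr y2)
      by_cases hxJ : x ∈ J u
      · obtain ⟨r0, hr0, hh⟩ := h.local_sides hP hcl hfr hxJ
        exact windN_germ hm (by omega) (lt_min hr0 hε) (hh (min r0 ε) (lt_min hr0 hε) (min_le_left _ _)).2
          (hdis _ (min_le_right _ _))
      · have hxi : x ∈ interior P := by
          by_contra hc
          apply hxJ
          rw [← hfr, hP.frontier_eq]
          exact ⟨hCP hx, hc⟩
        obtain ⟨r0, hr0, hh⟩ := Metric.isOpen_iff.1 isOpen_interior x hxi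
        refine windN_germ hm (by omega) (lt_min hr0 hε) ?_ (hdis _ (min_le_right r0 ε))
        rw [Set.inter_eq_self_of_subset_right ((Metric.ball_subset_ball (min_le_left _ _)).trans hh)]
        exact (convex_ball _ _).isPreconnected) ha hb
  have hbe : ∀ k < 2*n+2, γ b ∉ segment ℝ (w k) (w (k+1)) := by
    intro k hk hc
    rcases hcase k hk with h1 | rfl | rfl
    · obtain ⟨τ, ⟨τ1, τ2⟩, hτ⟩ := hedge k h1 hc
      have q1 := cl_s k
      have q2 := cl_t (k+1)
      have := h.gam_inj (by linarith) (by linarith) (by linarith) (by linarith)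
        (by rw [abs_lt]; constructor <;> linarith) hτ
      linarith
    · rw [w2n, w2n1] at hc; exact Set.disjoint_left.1 hC1 hb hc
    · rw [w2n1, w2n2] at hc; exact Set.disjoint_left.1 hC2 hb hc
  have hm12 : m1 = m2 := by
    have hFc : IsClosed (⋃ k ∈ {k : ℕ | k < 2*n+2}, segment ℝ (w k) (w (k+1))) :=
      (Set.finite_lt_nat _).isClosed_biUnion (fun _ _ => seg_closed _ _)
    have hbF : γ b ∈ (⋃ k ∈ {k : ℕ | k < 2*n+2}, segment ℝ (w k) (w (k+1)))ᶜ := by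
      intro hc
      simp only [Set.mem_iUnion] at hc
      obtain ⟨k, hk, hk'⟩ := hc
      exact hbe k hk hk'
    obtain ⟨ε, hε, hbK⟩ := Metric.isOpen_iff.1 hFc.isOpen_compl _ hbF
    obtain ⟨c, hc⟩ := windN_germ (D := Set.univ) (x := γ b) hm (by omega) hε
      (by rw [Set.univ_inter]; exact (convex_ball _ _).isPreconnected)
      (by
        intro k hk
        rw [Set.disjoint_left]
        rintro y ⟨_, y1⟩ y2
        apply hbK y1
        simp only [Set.mem_iUnion]
        exact ⟨k, hk, y2⟩)
    rw [nhdsWithin_univ] at hc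
    have n1 : (𝓝[Pᶜ] (γ b)).NeBot := mem_closure_iff_nhdsWithin_neBot.1 (by
      rw [← hfr, frontier_eq_closure_inter_closure] at hγb; exact hγb.2)
    have n2 : (𝓝[interior P] (γ b)).NeBot := mem_closure_iff_nhdsWithin_neBot.1 (hcl ▸ hCP hb)
    obtain ⟨y, y1, y2⟩ := (m1b.and (hc.filter_mono nhdsWithin_le_nhds)).exists
    obtain ⟨y', y1', y2'⟩ := (m2b.and (hc.filter_mono nhdsWithin_le_nhds)).exists
    rw [← y1, y2, ← y2', y1']
  subst hm12
  have hA : ∀ᶠ y in 𝓝 (γ a), y ∉ J u → windN w (2*n+2) y = m1 := by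
    filter_upwards [eventually_nhdsWithin_iff.1 m1a, eventually_nhdsWithin_iff.1 m2a] with y y1 y2 y3
    by_cases hyP : y ∈ P
    · apply y2
      by_contra hc
      apply y3
      rw [← hfr, hP.frontier_eq]
      exact ⟨hyP, hc⟩
    · exact y1 hyP
  have a0 : 0 ≤ a := by linarith
  have f1 := Nat.floor_le a0
  have f2 := Nat.lt_floor_add_one a
  set k := ⌊a⌋₊ with hk
  have f3 : (k:ℝ) < a := lt_of_le_of_ne f1 (hai k).symm
  have hk2 : k < 2*n := by rw [hk, Nat.floor_lt a0]; push_cast; linarith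
  have c1 : cl k < a := max_lt hsa ((min_le_left _ _).trans_lt f3)
  have c2 : a < cl (k+1) := lt_max_of_lt_right (lt_min (by push_cast; exact f2) hat)
  have c3 : (k:ℝ) ≤ cl k := by
    simp only [hcldef]; rw [min_eq_left (by linarith)]; exact le_max_right _ _
  have c4 : cl (k+1) ≤ (k:ℝ) + 1 := by
    simp only [hcldef]; push_cast; exact max_le (by linarith) (min_le_left _ _)
  have e1 : w k = u k + ((cl k - k : ℝ):ℂ) * (u (k+1) - u k) := by
    rw [hwk k hk2.le, hγ, gam_on u _ k hk2 _ c3 (by linarith)]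
  have e2 : w (k+1) = u k + ((cl (k+1) - k : ℝ):ℂ) * (u (k+1) - u k) := by
    rw [hwk (k+1) hk2, hγ, gam_on u _ k hk2 _ (by linarith) c4]
  have e3 : γ a = u k + ((a - k : ℝ):ℂ) * (u (k+1) - u k) := by
    rw [hγ, gam_on u _ k hk2 _ f1 f2.le]
  have hd : u (k+1) - u k ≠ 0 := sub_ne_zero.2 (h.ne k).symm
  have hΔ : 0 < cl (k+1) - cl k := by linarith
  have hΔc : (((cl (k+1) - cl k : ℝ)):ℂ) ≠ 0 := by exact_mod_cast hΔ.ne'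
  have e4 : w (k+1) - w k = ((cl (k+1) - cl k : ℝ):ℂ) * (u (k+1) - u k) := by
    rw [e1, e2]; push_cast; ring
  refine windN_jump (w := w) (m := 2*n+2) (k := k) (by omega) (l := (a - cl k) / (cl (k+1) - cl k))
    (div_pos (by linarith) hΔ) (by rw [div_lt_one hΔ]; linarith) ?_ (a := γ a) ?_ ?_ m1 ?_
  · intro hc
    have : w (k+1) - w k = 0 := by rw [hc]; ring
    rw [e4] at this
    exact (mul_ne_zero hΔc hd) this
  · rw [e4, e1, e3]
    push_cast at hΔc ⊢
    field_simp
    ring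
  · intro j hj hjk hc
    rcases hcase j hj with h1 | rfl | rfl
    · obtain ⟨τ, ⟨τ1, τ2⟩, hτ⟩ := hedge j h1 hc
      have q1 := cl_s j
      have q2 := cl_t (j+1)
      have hτa := h.gam_inj (by linarith) (by linarith) (by linarith) (by linarith)
        (by rw [abs_lt]; constructor <;> linarith) hτ
      rw [hτa] at τ1 τ2
      apply hjk
      have j1 : (j:ℝ) ≤ a := by
        have : min (j:ℝ) t ≤ a := (le_max_right _ _).trans τ1
        rcases min_le_iff.1 this with h | h
        · exact h
        · linarith
      have j2 : a ≤ (j:ℝ) + 1 := by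
        rcases le_max_iff.1 τ2 with h | h
        · linarith
        · have := h.trans (min_le_left _ _); push_cast at this; exact this
      have j3 : a < (j:ℝ) + 1 := lt_of_le_of_ne j2 (by have := hai (j+1); push_cast at this; exact this)
      exact ((Nat.floor_eq_iff a0).2 ⟨j1, j3⟩).symm
    · rw [w2n, w2n1] at hc; exact Set.disjoint_left.1 hC1 ha hc
    · rw [w2n1, w2n2] at hc; exact Set.disjoint_left.1 hC2 ha hc
  · obtain ⟨ε, hε, hnear⟩ := h.J_near (γ a)
    have htend : Tendsto (fun e : ℝ => γ a + e * Complex.I * (w (k+1) - w k)) (𝓝 0) (𝓝 (γ a)) := by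
      have : ContinuousAt (fun e : ℝ => γ a + e * Complex.I * (w (k+1) - w k)) 0 := by fun_prop
      have h3 := this.tendsto
      simpa using h3
    rw [eventually_nhdsWithin_iff]
    filter_upwards [htend.eventually hA, htend.eventually (Metric.ball_mem_nhds (γ a) hε)] with e y1 y2 he
    apply y1
    intro hyJ
    obtain ⟨l, l1, l2⟩ := hnear _ hyJ y2
    rw [e3] at l1
    rcases h.edges_through (by linarith) (by linarith) l1 with hc | ⟨hc, _⟩
    · rw [h.seg_eq hc.symm] at l2
      obtain ⟨x, x0, x1, hx⟩ := mem_seg_iff.1 l2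
      rw [e3, e4] at hx
      have : ((a - k - x : ℝ) + (e * (cl (k+1) - cl k) : ℝ) * Complex.I : ℂ) * (u (k+1) - u k) = 0 := by
        push_cast at hx ⊢
        linear_combination hx
      have := (mul_eq_zero.1 this).resolve_right hd
      have := congrArg Complex.im this
      simp at this
      rcases this with h | h
      · exact he h
      · linarith
    · linarith

end SimpPoly

lemma vis_closed {P : Set ℂ} (hP : IsClosed P) (p : ℂ) : IsClosed {q : ℂ | q ∈ P ∧ segment ℝ p q ⊆ P} := by
  have e : {q : ℂ | q ∈ P ∧ segment ℝ p q ⊆ P} = P ∩ ⋂ t ∈ Set.Icc (0:ℝ) 1, {q : ℂ | p + t * (q - p) ∈ P} := by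
    ext q
    simp only [Set.mem_ofPred_eq, Set.mem_inter_iff, Set.mem_iInter]
    constructor
    · rintro ⟨h1, h2⟩
      exact ⟨h1, fun t ht => h2 (mem_seg_iff.2 ⟨t, ht.1, ht.2, rfl⟩)⟩
    · rintro ⟨h1, h2⟩
      refine ⟨h1, fun y hy => ?_⟩
      obtain ⟨t, t0, t1, rfl⟩ := mem_seg_iff.1 hy
      exact h2 t ⟨t0, t1⟩
  rw [e]
  refine hP.inter (isClosed_biInter fun t _ => ?_)
  exact hP.preimage (f := fun q : ℂ => p + t * (q - p)) (by fun_prop)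

lemma vis_seg {P : Set ℂ} {p q : ℂ} (h : q ∈ {q : ℂ | q ∈ P ∧ segment ℝ p q ⊆ P}) :
    segment ℝ p q ⊆ {q : ℂ | q ∈ P ∧ segment ℝ p q ⊆ P} := by
  intro y hy
  refine ⟨h.2 hy, ?_⟩
  exact ((convex_segment p q).segment_subset (left_mem_segment ℝ _ _) hy).trans h.2

/-- every pocket touches the frontier -/
lemma pocket_touch {P : Set ℂ} (hP : IsCompact P) {p : ℂ} (hp : p ∈ P) {C : Set ℂ}
    (hmax : ∀ S : Set ℂ, IsPreconnected S → S ⊆ P \ {q : ℂ | q ∈ P ∧ segment ℝ p q ⊆ P} →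
      (S ∩ C).Nonempty → S ⊆ C)
    (hCs : C ⊆ P \ {q : ℂ | q ∈ P ∧ segment ℝ p q ⊆ P}) (hne : C.Nonempty) : (C ∩ frontier P).Nonempty := by
  obtain ⟨x, hx⟩ := hne
  have hxP := (hCs hx).1
  have hxV := (hCs hx).2
  have hxp : x - p ≠ 0 := by
    intro h
    apply hxV
    rw [sub_eq_zero] at h
    refine ⟨hxP, ?_⟩
    rw [h, segment_same]
    simpa using hp
  set f : ℝ → ℂ := fun t => p + t * (x - p) with hf
  have hfc : Continuous f := by fun_prop
  have f1 : f 1 = x := by simp [hf]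
  set T : Set ℝ := {t | 1 ≤ t ∧ f t ∉ P} with hT
  have hTne : T.Nonempty := by
    obtain ⟨R, hR⟩ := hP.isBounded.subset_closedBall p
    have hpos : 0 < ‖x - p‖ := norm_pos_iff.2 hxp
    refine ⟨max 1 ((|R| + 1) / ‖x - p‖), le_max_left _ _, fun hc => ?_⟩
    have h1 := hR hc
    rw [mem_closedBall_iff_norm, hf] at h1
    simp only [add_sub_cancel_left, norm_mul, Complex.norm_real] at h1
    rw [Real.norm_of_nonneg (by positivity)] at h1
    have h2 : (|R| + 1) / ‖x - p‖ * ‖x - p‖ = |R| + 1 := by field_simp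
    have h3 := mul_le_mul_of_nonneg_right (le_max_right 1 ((|R| + 1) / ‖x - p‖)) hpos.le
    have := le_abs_self R
    linarith
  have hTb : BddBelow T := ⟨1, fun t ht => ht.1⟩
  set t1 := sInf T with ht1
  have h1t : 1 ≤ t1 := le_csInf hTne (fun t ht => ht.1)
  have hin : ∀ t, 1 ≤ t → t < t1 → f t ∈ P := by
    intro t h1 h2
    by_contra hc
    exact absurd (csInf_le hTb (show t ∈ T from ⟨h1, hc⟩)) (not_le.2 h2)
  have hinP : f t1 ∈ P := by
    rcases h1t.eq_or_lt with h | h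
    · rw [← h, f1]; exact hxP
    · have hmem : t1 ∈ closure (Set.Ico 1 t1) := by
        rw [closure_Ico h.ne]; exact ⟨h.le, le_rfl⟩
      have := map_mem_closure hfc hmem (t := P) (fun t ht => hin t ht.1 ht.2)
      rwa [hP.isClosed.closure_eq] at this
  have hout : f t1 ∈ closure Pᶜ :=
    map_mem_closure hfc (csInf_mem_closure hTne hTb) (fun t ht => ht.2)
  have hSs : f '' Set.Icc 1 t1 ⊆ P \ {q : ℂ | q ∈ P ∧ segment ℝ p q ⊆ P} := by
    rintro _ ⟨t, ⟨h1, h2⟩, rfl⟩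
    constructor
    · rcases h2.lt_or_eq with h | h
      · exact hin t h1 h
      · rw [h]; exact hinP
    · intro hv
      apply hxV
      apply vis_seg hv
      refine mem_seg_iff.2 ⟨1 / t, by positivity, by rw [div_le_one (by linarith)]; exact h1, ?_⟩
      have : (t:ℂ) ≠ 0 := by
        have : t ≠ 0 := by linarith
        exact_mod_cast this
      simp only [hf]
      push_cast
      field_simp
      ring
  have := hmax (f '' Set.Icc 1 t1) (isPreconnected_Icc.image _ hfc.continuousOn) hSs
    ⟨x, ⟨1, ⟨le_rfl, h1t⟩, f1⟩, hx⟩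
  refine ⟨f t1, this ⟨t1, ⟨h1t, le_rfl⟩, rfl⟩, ?_⟩
  rw [frontier_eq_closure_inter_closure]
  exact ⟨subset_closure hinP, hout⟩

lemma SimpPoly.core {n : ℕ} {u : ℕ → ℂ} (h : SimpPoly n u) {P : Set ℂ} (hP : IsCompact P)
    (hcl : P = closure (interior P)) (hfr : frontier P = SimpPoly.J u) {p : ℂ} (hp : p ∈ P) {C : Set ℂ}
    (hmax : ∀ S : Set ℂ, IsPreconnected S → S ⊆ P \ {q : ℂ | q ∈ P ∧ segment ℝ p q ⊆ P} →
      (S ∩ C).Nonempty → S ⊆ C)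
    (hCs : C ⊆ P \ {q : ℂ | q ∈ P ∧ segment ℝ p q ⊆ P}) (hCpre : IsPreconnected C)
    (hne : C.Nonempty) : IsConnected (C ∩ frontier P) := by
  have hnon := pocket_touch hP hp hmax hCs hne
  refine ⟨hnon, ?_⟩
  rw [hfr] at hnon ⊢
  set V := {q : ℂ | q ∈ P ∧ segment ℝ p q ⊆ P} with hV
  have hVc : IsClosed V := vis_closed hP.isClosed p
  have hJP : SimpPoly.J u ⊆ P := by rw [← hfr]; exact hP.isClosed.frontier_subset
  have hnR : (0:ℝ) < n := by have := h.two; positivity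
  by_cases hJV : ∃ s : ℝ, 0 ≤ s ∧ s < n ∧ gam u (2*n) s ∈ V
  · obtain ⟨s, hs0, hsn, hsV⟩ := hJV
    have hγc := gam_continuous u (2*n)
    set γ := gam u (2*n) with hγ
    have key : ∀ a b : ℝ, s < a → a < b → b < s + n → γ a ∈ C → γ b ∈ C → ∀ t, a ≤ t → t ≤ b → γ t ∉ V := by
      intro a b hsa hab hbs haC hbC t hat htb htV
      have hat' : a < t := lt_of_le_of_ne hat (by rintro rfl; exact (hCs haC).2 htV)
      have htb' : t < b := lt_of_le_of_ne htb (by rintro rfl; exact (hCs hbC).2 htV)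
      obtain ⟨a', ha1, ha2, ha3, ha4⟩ : ∃ a', s < a' ∧ a' < t ∧ (∀ k : ℕ, a' ≠ k) ∧ γ a' ∈ C := by
        have hopen : IsOpen (γ ⁻¹' Vᶜ) := hVc.isOpen_compl.preimage hγc
        obtain ⟨δ, hδ, hball⟩ := Metric.isOpen_iff.1 hopen a (hCs haC).2
        have hfl := Nat.lt_floor_add_one a
        have hfl2 := Nat.floor_le (show 0 ≤ a by linarith)
        obtain ⟨a', q1, q2⟩ := exists_between
          (show a < min (min t (a + δ)) (⌊a⌋₊ + 1) from lt_min (lt_min hat' (by linarith)) hfl)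
        have q3 : a' < t := q2.trans_le ((min_le_left _ _).trans (min_le_left _ _))
        have q4 : a' < a + δ := q2.trans_le ((min_le_left _ _).trans (min_le_right _ _))
        have q5 : a' < ⌊a⌋₊ + 1 := q2.trans_le (min_le_right _ _)
        refine ⟨a', by linarith, q3, ?_, ?_⟩
        · intro k hk
          rw [hk] at q5 q1
          have q6 : k < ⌊a⌋₊ + 1 := by exact_mod_cast q5
          have q7 : (⌊a⌋₊ : ℝ) < k := by linarith
          have q8 : ⌊a⌋₊ < k := by exact_mod_cast q7
          omega
        · refine hmax (γ '' Set.Icc a a') (isPreconnected_Icc.image _ hγc.continuousOn) ?_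
            ⟨γ a, ⟨a, ⟨le_rfl, q1.le⟩, rfl⟩, haC⟩ ⟨a', ⟨q1.le, le_rfl⟩, rfl⟩
          rintro _ ⟨τ, ⟨t1, t2⟩, rfl⟩
          refine ⟨hJP (h.gam_mem (by linarith) (by linarith)), ?_⟩
          apply hball
          rw [Metric.mem_ball, Real.dist_eq, abs_lt]
          constructor <;> linarith
      have hsegV : segment ℝ (γ t) p ⊆ V := by rw [segment_symm]; exact vis_seg htV
      have hsegV' : segment ℝ p (γ s) ⊆ V := vis_seg hsV
      exact h.crossing hP.isClosed hcl hfr hs0 ha1 ha2 htb' hbs hsn ha3 hCpre (fun y hy => (hCs hy).1)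
        (fun y hy => (hsegV hy).1) (fun y hy => (hsegV' hy).1)
        (Set.disjoint_left.2 fun y hy hy' => (hCs hy).2 (hsegV hy'))
        (Set.disjoint_left.2 fun y hy hy' => (hCs hy).2 (hsegV' hy')) ha4 hbC
    have himg : C ∩ SimpPoly.J u = γ '' {τ | s < τ ∧ τ < s + n ∧ γ τ ∈ C} := by
      ext z
      constructor
      · rintro ⟨hzC, hzJ⟩
        obtain ⟨k, hk⟩ := Set.mem_iUnion.1 hzJ
        obtain ⟨τ, h1, h2, rfl⟩ := h.gam_surj hk
        rcases lt_trichotomy τ s with hlt | heq | hgt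
        · refine ⟨τ + n, ⟨by linarith, by linarith, ?_⟩, h.gam_per h1 (by linarith)⟩
          rw [hγ, h.gam_per h1 (by linarith)]; exact hzC
        · exfalso; rw [heq] at hzC; exact (hCs hzC).2 hsV
        · by_cases hτ : τ < s + n
          · exact ⟨τ, ⟨hgt, hτ, hzC⟩, rfl⟩
          · exfalso
            have e1 : s = 0 := by linarith
            have e2 : τ = 0 + n := by linarith
            rw [e2, h.gam_per le_rfl hnR] at hzC
            rw [e1] at hsV
            exact (hCs hzC).2 hsV
      · rintro ⟨τ, ⟨h1, h2, h3⟩, rfl⟩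
        exact ⟨h3, h.gam_mem (by linarith) (by linarith)⟩
    rw [himg]
    refine IsPreconnected.image ?_ _ hγc.continuousOn
    refine Set.OrdConnected.isPreconnected ⟨?_⟩
    rintro a ⟨a1, a2, a3⟩ b ⟨b1, b2, b3⟩ c ⟨c1, c2⟩
    rcases (c1.trans c2).eq_or_lt with hab | hab
    · have : c = a := le_antisymm (by rw [hab]; exact c2) c1
      rw [this]; exact ⟨a1, a2, a3⟩
    · refine ⟨by linarith, by linarith, ?_⟩
      refine hmax (γ '' Set.Icc a b) (isPreconnected_Icc.image _ hγc.continuousOn) ?_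
        ⟨γ a, ⟨a, ⟨le_rfl, hab.le⟩, rfl⟩, a3⟩ ⟨c, ⟨c1, c2⟩, rfl⟩
      rintro _ ⟨τ, ⟨t1, t2⟩, rfl⟩
      exact ⟨hJP (h.gam_mem (by linarith) (by linarith)), key a b a1 hab b2 a3 b3 τ t1 t2⟩
  · push Not at hJV
    have hJs : SimpPoly.J u ⊆ P \ V := by
      intro z hz
      refine ⟨hJP hz, ?_⟩
      obtain ⟨k, hk⟩ := Set.mem_iUnion.1 hz
      obtain ⟨τ, h1, h2, rfl⟩ := h.gam_surj hk
      rcases h2.lt_or_eq with h3 | h3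
      · exact hJV τ h1 h3
      · have : τ = 0 + n := by linarith
        rw [this, h.gam_per le_rfl hnR]
        exact hJV 0 le_rfl hnR
    have := hmax _ h.J_pre hJs (by rw [Set.inter_comm]; exact hnon)
    rw [Set.inter_eq_self_of_subset_right this]
    exact h.J_pre

lemma simp_inj {n : ℕ} [NeZero n]
    (P : Set (EuclideanSpace ℝ (Fin 2))) (v : Fin n → EuclideanSpace ℝ (Fin 2))
    (hP : IsSimplePolygonRegion P v) (i j : Fin n) (x y : ℝ) (x0 : 0 ≤ x) (x1 : x < 1) (y0 : 0 ≤ y) (y1 : y < 1)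
    (he : v i + x • (v (i+1) - v i) = v j + y • (v (j+1) - v j)) : i = j ∧ x = y := by
  obtain ⟨hn, hinj, -, -, -, -, hcons, hdis⟩ := hP
  have hne : ∀ i : Fin n, v (i+1) - v i ≠ 0 := by
    intro i hc
    have := hinj (sub_eq_zero.1 hc)
    have h1 : (1 : Fin n) = 0 := by simpa using this
    have h2 := congrArg Fin.val h1
    rw [Fin.val_one', Fin.val_zero, Nat.mod_eq_of_lt (by omega)] at h2
    omega
  have hmem : ∀ (i : Fin n) (x : ℝ), 0 ≤ x → x < 1 → v i + x • (v (i+1) - v i) ∈ segment ℝ (v i) (v (i+1)) := by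
    intro i x h0 h1
    rw [segment_eq_image']
    exact ⟨x, ⟨h0, h1.le⟩, rfl⟩
  have hlast : ∀ (i : Fin n) (x : ℝ), x < 1 → v i + x • (v (i+1) - v i) ≠ v (i+1) := by
    intro i x h1 hc
    have h2 : (1 - x) • (v (i+1) - v i) = 0 := by
      rw [sub_smul, one_smul, sub_eq_zero, sub_eq_iff_eq_add, add_comm (x • _)]; exact hc.symm
    rcases smul_eq_zero.1 h2 with h | h
    · linarith
    · exact hne i h
  by_cases hij : i = j
  · subst hij
    refine ⟨rfl, ?_⟩
    have h1 : (x - y) • (v (i+1) - v i) = 0 := by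
      rw [sub_smul, sub_eq_zero]; exact add_left_cancel he
    rcases smul_eq_zero.1 h1 with h | h
    · linarith
    · exact absurd h (hne i)
  · exfalso
    have m1 := hmem i x x0 x1
    have m2 := hmem j y y0 y1
    by_cases h1 : j = i + 1
    · subst h1
      rw [← he] at m2
      have := (hcons i).subset ⟨m1, m2⟩
      exact hlast i x x1 this
    · by_cases h2 : i = j + 1
      · subst h2
        rw [he] at m1
        have := (hcons j).subset ⟨m2, m1⟩
        exact hlast j y y1 this
      · rw [← he] at m2
        exact Set.disjoint_left.1 (hdis i j hij h1 h2) m1 m2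

theorem pocket_boundary_connected {n : ℕ} [NeZero n]
    (P : Set (EuclideanSpace ℝ (Fin 2))) (v : Fin n → EuclideanSpace ℝ (Fin 2))
    (hP : IsSimplePolygonRegion P v)
    (p : EuclideanSpace ℝ (Fin 2)) (hp : p ∈ P)
    (C : Set (EuclideanSpace ℝ (Fin 2)))
    (hC : ∃ x ∈ P \ {q | q ∈ P ∧ segment ℝ p q ⊆ P},
      C = connectedComponentIn (P \ {q | q ∈ P ∧ segment ℝ p q ⊆ P}) x) :
    IsConnected (C ∩ frontier P) := by
  have hinj := simp_inj P v hP
  obtain ⟨hn, -, hcomp, -, hcl, hfr, -, -⟩ := hP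
  obtain ⟨x, hx, rfl⟩ := hC
  set φ : EuclideanSpace ℝ (Fin 2) ≃ₗᵢ[ℝ] ℂ := Complex.orthonormalBasisOneI.repr.symm with hφ
  set ψ : EuclideanSpace ℝ (Fin 2) ≃ₜ ℂ := φ.toHomeomorph with hψ
  have hψφ : ∀ y, ψ y = φ y := fun y => rfl
  have hseg : ∀ a b, ψ '' segment ℝ a b = segment ℝ (φ a) (φ b) := fun a b =>
    image_segment ℝ φ.toLinearEquiv.toLinearMap.toAffineMap a b
  set u : ℕ → ℂ := fun k => φ (v (Fin.ofNat n k)) with hu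
  have hsucc : ∀ k, Fin.ofNat n (k+1) = Fin.ofNat n k + 1 := by
    intro k
    apply Fin.ext
    simp [Fin.val_add]
  have hS : SimpPoly n u := by
    refine ⟨by omega, ?_, ?_⟩
    · intro k
      have : Fin.ofNat n (k+n) = Fin.ofNat n k := by apply Fin.ext; simp
      simp only [hu, this]
    · intro k l x y x0 x1 y0 y1 he
      simp only [hu, hsucc] at he
      have h1 := hinj (Fin.ofNat n k) (Fin.ofNat n l) x y x0 x1 y0 y1 (by
        apply φ.injective
        simp only [map_add, map_smul, map_sub, Complex.real_smul]
        exact he)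
      refine ⟨?_, h1.2⟩
      have := congrArg Fin.val h1.1
      simpa [Nat.ModEq] using this
  have hVimg : ψ '' (P \ {q | q ∈ P ∧ segment ℝ p q ⊆ P}) =
      (ψ '' P) \ {q : ℂ | q ∈ ψ '' P ∧ segment ℝ (ψ p) q ⊆ ψ '' P} := by
    rw [Set.image_sdiff ψ.injective]
    congr 1
    ext q
    constructor
    · rintro ⟨y, ⟨y1, y2⟩, rfl⟩
      refine ⟨⟨y, y1, rfl⟩, ?_⟩
      rw [hψφ, hψφ, ← hseg]
      exact Set.image_mono y2
    · rintro ⟨⟨y, y1, rfl⟩, y2⟩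
      refine ⟨y, ⟨y1, ?_⟩, rfl⟩
      rw [hψφ, hψφ, ← hseg] at y2
      exact (Set.image_subset_image_iff ψ.injective).1 y2
  set F := P \ {q | q ∈ P ∧ segment ℝ p q ⊆ P} with hF
  have hCimg := ψ.image_connectedComponentIn hx
  have hcore := hS.core (P := ψ '' P) (p := ψ p) (C := ψ '' connectedComponentIn F x)
    (hcomp.image ψ.continuous)
    (by rw [← ψ.image_interior, ← ψ.image_closure, ← hcl])
    (by
      rw [← ψ.image_frontier, hfr, Set.image_iUnion]
      apply Set.Subset.antisymm
      · refine Set.iUnion_subset fun i => ?_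
        rw [hseg]
        refine Set.Subset.trans ?_ (Set.subset_iUnion _ (i : ℕ))
        simp only [hu, hsucc]
        simp
      · refine Set.iUnion_subset fun k => ?_
        refine Set.Subset.trans ?_ (Set.subset_iUnion _ (Fin.ofNat n k))
        simp only [hu, hsucc, hseg]
        exact subset_rfl)
    ⟨p, hp, rfl⟩
    (by
      rintro S hSp hSs ⟨y, y1, y2⟩
      rw [← hVimg] at hSs
      rw [hCimg] at y2 ⊢
      rw [connectedComponentIn_eq y2]
      exact hSp.subset_connectedComponentIn y1 hSs)
    (by
      rw [← hVimg]
      exact Set.image_mono (connectedComponentIn_subset _ _))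
    (isPreconnected_connectedComponentIn.image _ ψ.continuous.continuousOn)
    ⟨ψ x, x, mem_connectedComponentIn hx, rfl⟩
  rw [← ψ.image_frontier, ← Set.image_inter ψ.injective] at hcore
  exact ψ.isConnected_image.1 hcore
end
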